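/- arXiv:1705.06749 — 2 statements merged into one kernel-verified Lean document; each statement's English description precedes it below -/
import Mathlib

section
/- Let A, B, C be finite-dimensional complex Hilbert spaces, let ρ_ABC be a density operator on A⊗B⊗C with marginal ρ_AB, and let R_{B→BC} be a trace-preserving completely positive map from operators on B to operators on B⊗C. Then D( ρ_ABC ‖ (id_A⊗R_{B→BC})(ρ_AB) ) ≥ I(A:C|B)_ρ^4 / ( 8 ln 2 · (log₂(dim A) + 1)^4 ). -/
open scoped ComplexOrder

noncomputable section

namespace QIT

variable {n : Type*} [Fintype n] [DecidableEq n]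

/-- `x ↦ x·log₂ x` with the convention `0·log 0 = 0`. -/
def xlog (x : ℝ) : ℝ := if x = 0 then 0 else x * Real.logb 2 x

/-- Von Neumann entropy (base 2) of a matrix, via its eigenvalues. -/
def vN (ρ : Matrix n n ℂ) : ℝ :=
  if h : ρ.IsHermitian then -∑ i, xlog (h.eigenvalues i) else 0

/-- Matrix logarithm (base 2) via functional calculus on the support. -/
def matLog (ρ : Matrix n n ℂ) : Matrix n n ℂ :=
  if h : ρ.IsHermitian then
    (h.eigenvectorUnitary : Matrix n n ℂ) *
      Matrix.diagonal (fun i =>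
        ((if h.eigenvalues i = 0 then 0 else Real.logb 2 (h.eigenvalues i) : ℝ) : ℂ)) *
      (star (h.eigenvectorUnitary : Matrix n n ℂ))
  else 0

/-- Support inclusion: `supp ρ ⊆ supp σ` (for PSD matrices: `ker σ ⊆ ker ρ`). -/
def suppLe (ρ σ : Matrix n n ℂ) : Prop := ∀ v, σ.mulVec v = 0 → ρ.mulVec v = 0

open Classical in
/-- Umegaki relative entropy (base 2), `+∞` if the support condition fails. -/
def relEnt (ρ σ : Matrix n n ℂ) : EReal :=
  if suppLe ρ σ then (((ρ * (QIT.matLog ρ - QIT.matLog σ)).trace.re : ℝ) : EReal) else ⊤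

/-- Max-relative entropy `D_max(ρ‖σ) = inf{λ : ρ ≤ 2^λ σ}`, `+∞` if no such λ. -/
def dMax (ρ σ : Matrix n n ℂ) : EReal :=
  sInf {x : EReal | ∃ l : ℝ, x = (l : EReal) ∧ ((2 : ℝ) ^ l • σ - ρ).PosSemidef}

/-- Partial trace over the first tensor factor. -/
def ptrFst {α β : Type*} [Fintype α] (M : Matrix (α × β) (α × β) ℂ) : Matrix β β ℂ :=
  Matrix.of fun x y => ∑ i, M (i, x) (i, y)

/-- Partial trace over the second tensor factor. -/
def ptrSnd {α β : Type*} [Fintype β] (M : Matrix (α × β) (α × β) ℂ) : Matrix α α ℂ :=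
  Matrix.of fun x y => ∑ k, M (x, k) (y, k)

/-- Partial trace over the third factor of a tripartite system. -/
def ptrC3 {α β γ : Type*} [Fintype γ] (M : Matrix (α × β × γ) (α × β × γ) ℂ) :
    Matrix (α × β) (α × β) ℂ :=
  Matrix.of fun x y => ∑ k, M (x.1, x.2, k) (y.1, y.2, k)

/-- Conditional mutual information `I(A:C|B) = H(AB) + H(BC) - H(B) - H(ABC)`. -/
def cmi {α β γ : Type*} [Fintype α] [Fintype β] [Fintype γ]
    [DecidableEq α] [DecidableEq β] [DecidableEq γ]
    (ρ : Matrix (α × β × γ) (α × β × γ) ℂ) : ℝ :=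
  vN (ptrC3 ρ) + vN (ptrFst ρ) - vN (ptrSnd (ptrFst ρ)) - vN ρ

/-- Tensoring a map on the second factor with the identity on the first factor. -/
def tensorId {k b b' : Type*} (Φ : Matrix b b ℂ → Matrix b' b' ℂ)
    (M : Matrix (k × b) (k × b) ℂ) : Matrix (k × b') (k × b') ℂ :=
  Matrix.of fun x y => Φ (Matrix.of fun u v => M (x.1, u) (y.1, v)) x.2 y.2

/-- A quantum channel: linear, trace preserving and completely positive. -/
def IsCPTP {b b' : Type*} [Fintype b] [Fintype b']
    (Φ : Matrix b b ℂ →ₗ[ℂ] Matrix b' b' ℂ) : Prop :=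
  (∀ M, (Φ M).trace = M.trace) ∧
    ∀ (k : ℕ) (M : Matrix (Fin k × b) (Fin k × b) ℂ), M.PosSemidef →
      (tensorId (⇑Φ) M).PosSemidef

/-- `Λ_max(ρ_AB‖E)`: max-relative entropy distance from `ρ_AB` to the states
invariant under `id_A ⊗ E`. -/
def lambdaMax {a b : Type*} [Fintype a] [Fintype b]
    (ρ : Matrix (a × b) (a × b) ℂ) (E : Matrix b b ℂ → Matrix b b ℂ) : EReal :=
  ⨅ τ ∈ {τ : Matrix (a × b) (a × b) ℂ |
      τ.PosSemidef ∧ τ.trace = 1 ∧ tensorId E τ = τ}, dMax ρ τ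

end QIT


namespace QIT
open Matrix

/-- diagonal matrix with real entries -/
def rdiag {n : Type*} [DecidableEq n] (p : n → ℝ) : Matrix n n ℂ := diagonal fun i => (p i : ℂ)

theorem exists_spec {n : Type*} [Fintype n] [DecidableEq n] {ρ : Matrix n n ℂ} (h : ρ.IsHermitian) :
    ρ = (h.eigenvectorUnitary : Matrix n n ℂ) * rdiag h.eigenvalues *
      (h.eigenvectorUnitary : Matrix n n ℂ)ᴴ := by
  have := h.spectral_theorem
  rw [Unitary.conjStarAlgAut_apply] at this
  exact this

theorem eig_unitary {n : Type*} [Fintype n] [DecidableEq n] {ρ : Matrix n n ℂ} (h : ρ.IsHermitian) :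
    (h.eigenvectorUnitary : Matrix n n ℂ)ᴴ * (h.eigenvectorUnitary : Matrix n n ℂ) = 1 :=
  Unitary.coe_star_mul_self h.eigenvectorUnitary

theorem rdiag_conj_herm {n : Type*} [Fintype n] [DecidableEq n] (U : Matrix n n ℂ) (p : n → ℝ) :
    (U * rdiag p * Uᴴ).IsHermitian := by
  have : (rdiag p)ᴴ = rdiag p := by
    unfold rdiag
    rw [diagonal_conjTranspose]; congr 1; funext i; simp
  unfold IsHermitian
  rw [conjTranspose_mul, conjTranspose_mul, conjTranspose_conjTranspose, this, Matrix.mul_assoc]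

/-- functions of two diagonalizations of the same matrix agree -/
theorem two_diag {n : Type*} [Fintype n] [DecidableEq n] (U V : Matrix n n ℂ)
    (hU : Uᴴ * U = 1) (hV : Vᴴ * V = 1) (p q : n → ℝ) (f : ℝ → ℝ)
    (h : U * rdiag p * Uᴴ = V * rdiag q * Vᴴ) :
    U * rdiag (fun i => f (p i)) * Uᴴ = V * rdiag (fun i => f (q i)) * Vᴴ := by
  have hU' : U * Uᴴ = 1 := mul_eq_one_comm.mp hU
  have hV' : V * Vᴴ = 1 := mul_eq_one_comm.mp hV
  have h1 : (Vᴴ * U) * rdiag p = rdiag q * (Vᴴ * U) := by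
    calc (Vᴴ * U) * rdiag p = Vᴴ * (U * rdiag p * Uᴴ) * U := by
          simp only [Matrix.mul_assoc, hU, Matrix.mul_one]
      _ = rdiag q * (Vᴴ * U) := by
          rw [h]; simp only [← Matrix.mul_assoc, hV, Matrix.one_mul]
  have h2 : (Vᴴ * U) * rdiag (fun i => f (p i)) = rdiag (fun i => f (q i)) * (Vᴴ * U) := by
    ext i j
    have := congrFun (congrFun h1 i) j
    simp only [rdiag, mul_diagonal, diagonal_mul] at this ⊢
    by_cases hpq : p j = q i
    · rw [hpq, mul_comm]
    · have h0 : (Vᴴ * U) i j = 0 := by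
        have h3 : (Vᴴ * U) i j * ((p j : ℂ) - q i) = 0 := by rw [mul_sub, this]; ring
        rcases mul_eq_zero.mp h3 with h4 | h4
        · exact h4
        · exact absurd (by exact_mod_cast sub_eq_zero.mp h4) hpq
      simp [h0]
  calc U * rdiag (fun i => f (p i)) * Uᴴ = V * ((Vᴴ * U) * rdiag (fun i => f (p i))) * Uᴴ := by
        simp only [← Matrix.mul_assoc, hV', Matrix.one_mul]
    _ = _ := by
        rw [h2]; simp only [Matrix.mul_assoc, hU', Matrix.mul_one]

theorem matLog_spec {n : Type*} [Fintype n] [DecidableEq n] (U : Matrix n n ℂ)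
    (hU : Uᴴ * U = 1) (p : n → ℝ) :
    matLog (U * rdiag p * Uᴴ) = U * rdiag (fun i => Real.logb 2 (p i)) * Uᴴ := by
  have hh := rdiag_conj_herm U p
  have h1 := exists_spec hh
  rw [two_diag U _ hU (eig_unitary hh) p hh.eigenvalues (Real.logb 2) h1, matLog, dif_pos hh]
  congr 2
  unfold rdiag
  congr 1
  funext i
  split_ifs with h <;> simp [h]

theorem trace_two {n : Type*} [Fintype n] [DecidableEq n] (U V : Matrix n n ℂ) (a b : n → ℝ) :
    ((U * rdiag a * Uᴴ) * (V * rdiag b * Vᴴ)).trace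
      = ((∑ i, ∑ j, Complex.normSq ((Vᴴ * U) j i) * (a i * b j) : ℝ) : ℂ) := by
  have e : ((U * rdiag a * Uᴴ) * (V * rdiag b * Vᴴ)).trace
      = (rdiag a * (Vᴴ * U)ᴴ * rdiag b * (Vᴴ * U)).trace := by
    rw [conjTranspose_mul, conjTranspose_conjTranspose]
    simp only [Matrix.mul_assoc]
    rw [Matrix.trace_mul_comm]
    simp only [Matrix.mul_assoc]
  rw [e]
  simp only [trace, diag, Matrix.mul_apply (M := rdiag a * (Vᴴ * U)ᴴ * rdiag b)]
  push_cast
  refine Finset.sum_congr rfl fun i _ => Finset.sum_congr rfl fun j _ => ?_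
  simp only [rdiag, mul_diagonal, diagonal_mul, conjTranspose_apply, RCLike.star_def]
  rw [Complex.normSq_eq_conj_mul_self]; ring

theorem sum_normSq_row {n : Type*} [Fintype n] [DecidableEq n] (W : Matrix n n ℂ) (hW : Wᴴ * W = 1)
    (i : n) : ∑ j, Complex.normSq (W j i) = 1 := by
  have := congrFun (congrFun hW i) i
  simp only [Matrix.mul_apply, conjTranspose_apply, one_apply_eq, RCLike.star_def] at this
  have h2 : ((∑ j, Complex.normSq (W j i) : ℝ) : ℂ) = 1 := by
    push_cast
    rw [← this]
    exact Finset.sum_congr rfl fun j _ => by rw [Complex.normSq_eq_conj_mul_self]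
  exact_mod_cast h2

theorem trace_spec {n : Type*} [Fintype n] [DecidableEq n] (U : Matrix n n ℂ)
    (hU : Uᴴ * U = 1) (p : n → ℝ) : (U * rdiag p * Uᴴ).trace = ((∑ i, p i : ℝ) : ℂ) := by
  rw [Matrix.trace_mul_comm, ← Matrix.mul_assoc, hU, Matrix.one_mul]
  simp [rdiag]

/-- real relative entropy -/
def Dr {n : Type*} [Fintype n] [DecidableEq n] (ρ σ : Matrix n n ℂ) : ℝ :=
  (ρ * (matLog ρ - matLog σ)).trace.re

theorem Dr_spec {n : Type*} [Fintype n] [DecidableEq n] (U V : Matrix n n ℂ)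
    (hU : Uᴴ * U = 1) (hV : Vᴴ * V = 1) (p q : n → ℝ) :
    Dr (U * rdiag p * Uᴴ) (V * rdiag q * Vᴴ) =
      ∑ i, ∑ j, Complex.normSq ((Vᴴ * U) j i) * (p i * (Real.logb 2 (p i) - Real.logb 2 (q j))) := by
  have hV' : V * Vᴴ = 1 := mul_eq_one_comm.mp hV
  have hW : (Vᴴ * U)ᴴ * (Vᴴ * U) = 1 := by
    rw [conjTranspose_mul, conjTranspose_conjTranspose, Matrix.mul_assoc, ← Matrix.mul_assoc V, hV',
      Matrix.one_mul, hU]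
  unfold Dr
  rw [matLog_spec U hU, matLog_spec V hV, Matrix.mul_sub, trace_sub, trace_two, trace_two, hU,
    ← Complex.ofReal_sub, Complex.ofReal_re, ← Finset.sum_sub_distrib]
  refine Finset.sum_congr rfl fun i _ => ?_
  have h1 : ∑ j, Complex.normSq ((1 : Matrix n n ℂ) j i) * (p i * Real.logb 2 (p j))
      = p i * Real.logb 2 (p i) := by
    rw [Finset.sum_eq_single i]
    · simp
    · intro j _ hj; simp [one_apply_ne hj]
    · simp
  rw [h1]
  simp only [mul_sub, Finset.sum_sub_distrib]
  rw [← Finset.sum_mul, sum_normSq_row _ hW, one_mul]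

/-- the variational functional -/
def Fv {n : Type*} [Fintype n] (t : ℝ) (ρ σ X : Matrix n n ℂ) : ℝ :=
  2 * (X * ρ).trace.re - (X * Xᴴ * σ).trace.re - t * (Xᴴ * X * ρ).trace.re

theorem Fv_spec {n : Type*} [Fintype n] [DecidableEq n] (U V : Matrix n n ℂ)
    (hU : Uᴴ * U = 1) (hV : Vᴴ * V = 1) (p q : n → ℝ) (t : ℝ) (X : Matrix n n ℂ) :
    Fv t (U * rdiag p * Uᴴ) (V * rdiag q * Vᴴ) (V * X * Uᴴ) =
      ∑ i, ∑ j, (2 * (p i * (X j i * star ((Vᴴ * U) j i)).re)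
        - (q j + t * p i) * Complex.normSq (X j i)) := by
  have e1 : (V * X * Uᴴ * (U * rdiag p * Uᴴ)).trace
      = ∑ i, ∑ j, (p i : ℂ) * (X j i * star ((Vᴴ * U) j i)) := by
    have : (V * X * Uᴴ * (U * rdiag p * Uᴴ)).trace = (rdiag p * (Vᴴ * U)ᴴ * X).trace := by
      calc _ = (V * X * (Uᴴ * U) * rdiag p * Uᴴ).trace := by simp only [Matrix.mul_assoc]
        _ = _ := by
          rw [hU, Matrix.mul_one, conjTranspose_mul, conjTranspose_conjTranspose]
          simp only [Matrix.mul_assoc]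
          rw [← Matrix.mul_assoc V, Matrix.trace_mul_comm]
          simp only [Matrix.mul_assoc]
    rw [this]
    simp only [trace, diag, Matrix.mul_apply (M := rdiag p * (Vᴴ * U)ᴴ)]
    refine Finset.sum_congr rfl fun i _ => Finset.sum_congr rfl fun j _ => ?_
    simp only [rdiag, diagonal_mul, conjTranspose_apply]
    ring
  have hXs : (V * X * Uᴴ)ᴴ = U * Xᴴ * Vᴴ := by
    simp only [conjTranspose_mul, conjTranspose_conjTranspose, Matrix.mul_assoc]
  have e2 : ((V * X * Uᴴ) * (V * X * Uᴴ)ᴴ * (V * rdiag q * Vᴴ)).trace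
      = ∑ i, ∑ j, (q j : ℂ) * Complex.normSq (X j i) := by
    have : ((V * X * Uᴴ) * (V * X * Uᴴ)ᴴ * (V * rdiag q * Vᴴ)).trace
        = (rdiag q * X * Xᴴ).trace := by
      rw [hXs]
      calc _ = (V * X * (Uᴴ * U) * Xᴴ * (Vᴴ * V) * rdiag q * Vᴴ).trace := by
            simp only [Matrix.mul_assoc]
        _ = _ := by
          rw [hU, hV, Matrix.mul_one, Matrix.mul_one, Matrix.trace_mul_comm]
          simp only [← Matrix.mul_assoc]
          rw [hV, Matrix.one_mul, Matrix.trace_mul_comm]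
          simp only [← Matrix.mul_assoc]
    rw [this, Finset.sum_comm]
    simp only [trace, diag, Matrix.mul_apply (M := rdiag q * X)]
    refine Finset.sum_congr rfl fun i _ => Finset.sum_congr rfl fun j _ => ?_
    simp only [rdiag, diagonal_mul, conjTranspose_apply, RCLike.star_def]
    rw [Complex.normSq_eq_conj_mul_self]; ring
  have e3 : ((V * X * Uᴴ)ᴴ * (V * X * Uᴴ) * (U * rdiag p * Uᴴ)).trace
      = ∑ i, ∑ j, (p i : ℂ) * Complex.normSq (X j i) := by
    have : ((V * X * Uᴴ)ᴴ * (V * X * Uᴴ) * (U * rdiag p * Uᴴ)).trace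
        = (rdiag p * Xᴴ * X).trace := by
      rw [hXs]
      calc _ = (U * Xᴴ * (Vᴴ * V) * X * (Uᴴ * U) * rdiag p * Uᴴ).trace := by
            simp only [Matrix.mul_assoc]
        _ = _ := by
          rw [hU, hV, Matrix.mul_one, Matrix.mul_one, Matrix.trace_mul_comm]
          simp only [← Matrix.mul_assoc]
          rw [hU, Matrix.one_mul, Matrix.trace_mul_comm]
          simp only [← Matrix.mul_assoc]
    rw [this]
    simp only [trace, diag, Matrix.mul_apply (M := rdiag p * Xᴴ)]
    refine Finset.sum_congr rfl fun i _ => Finset.sum_congr rfl fun j _ => ?_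
    simp only [rdiag, diagonal_mul, conjTranspose_apply, RCLike.star_def]
    rw [Complex.normSq_eq_conj_mul_self]; ring
  unfold Fv
  rw [e1, e2, e3]
  simp only [Complex.re_sum, Complex.re_ofReal_mul, Complex.ofReal_re, Finset.mul_sum,
    ← Finset.sum_sub_distrib]
  refine Finset.sum_congr rfl fun i _ => Finset.sum_congr rfl fun j _ => ?_
  ring

/-- explicit maximal value of the variational functional -/
def Qs {n : Type*} [Fintype n] (t : ℝ) (W : Matrix n n ℂ) (p q : n → ℝ) : ℝ :=
  ∑ i, ∑ j, Complex.normSq (W j i) * (p i ^ 2 / (q j + t * p i))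

theorem Fv_le {n : Type*} [Fintype n] [DecidableEq n] (U V : Matrix n n ℂ)
    (hU : Uᴴ * U = 1) (hV : Vᴴ * V = 1) (p q : n → ℝ) (hp : ∀ i, 0 ≤ p i) (hq : ∀ i, 0 ≤ q i)
    (t : ℝ) (ht : 0 < t) (X : Matrix n n ℂ) :
    Fv t (U * rdiag p * Uᴴ) (V * rdiag q * Vᴴ) X ≤ Qs t (Vᴴ * U) p q := by
  have hV' : V * Vᴴ = 1 := mul_eq_one_comm.mp hV
  have hU' : U * Uᴴ = 1 := mul_eq_one_comm.mp hU
  have hX : X = V * (Vᴴ * X * U) * Uᴴ := by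
    calc X = (V * Vᴴ) * X * (U * Uᴴ) := by rw [hV', hU', Matrix.one_mul, Matrix.mul_one]
      _ = _ := by simp only [Matrix.mul_assoc]
  rw [hX, Fv_spec U V hU hV]
  refine Finset.sum_le_sum fun i _ => Finset.sum_le_sum fun j _ => ?_
  generalize (Vᴴ * X * U) j i = x
  generalize (Vᴴ * U) j i = w
  rcases (hp i).eq_or_lt with h0 | h0
  · rw [← h0]
    have := mul_nonneg (hq j) (Complex.normSq_nonneg x)
    simp; exact this
  · have hs : 0 < q j + t * p i := by have := hq j; positivity
    generalize q j + t * p i = s at hs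
    generalize p i = a at h0
    simp only [Complex.normSq_apply, RCLike.star_def, Complex.mul_re, Complex.conj_re,
      Complex.conj_im]
    rw [mul_div_assoc', le_div_iff₀ hs]
    nlinarith [sq_nonneg (s * x.re - a * w.re), sq_nonneg (s * x.im - a * w.im)]

theorem Fv_attain {n : Type*} [Fintype n] [DecidableEq n] (U V : Matrix n n ℂ)
    (hU : Uᴴ * U = 1) (hV : Vᴴ * V = 1) (p q : n → ℝ) (hp : ∀ i, 0 ≤ p i) (hq : ∀ i, 0 ≤ q i)
    (t : ℝ) (ht : 0 < t) :
    ∃ X, Fv t (U * rdiag p * Uᴴ) (V * rdiag q * Vᴴ) X = Qs t (Vᴴ * U) p q := by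
  refine ⟨V * (Matrix.of fun j i => ((p i / (q j + t * p i) : ℝ) : ℂ) * (Vᴴ * U) j i) * Uᴴ, ?_⟩
  rw [Fv_spec U V hU hV]
  refine Finset.sum_congr rfl fun i _ => Finset.sum_congr rfl fun j _ => ?_
  rw [of_apply]
  generalize (Vᴴ * U) j i = w
  rcases (hp i).eq_or_lt with h0 | h0
  · rw [← h0]; simp
  · have hs : 0 < q j + t * p i := by have := hq j; positivity
    generalize q j + t * p i = s at hs
    generalize p i = a at h0
    simp only [Complex.normSq_apply, RCLike.star_def, Complex.mul_re, Complex.conj_re,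
      Complex.conj_im, Complex.mul_im, Complex.ofReal_re, Complex.ofReal_im]
    field_simp
    ring

end QIT

namespace QIT
open Matrix Filter Topology MeasureTheory

theorem term_lim (w p q : ℝ) (hp : 0 ≤ p) (h : w = 0 ∨ p = 0 ∨ 0 < q) :
    (∀ T : ℝ, 0 ≤ T → IntervalIntegrable (fun t => w * (p ^ 2 / (q + t * p))) volume 0 T) ∧
    Tendsto (fun T => (∫ t in (0 : ℝ)..T, w * (p ^ 2 / (q + t * p))) - w * p * Real.log (1 + T))
      atTop (𝓝 (w * (p * (Real.log p - Real.log q)))) := by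
  by_cases h0 : w = 0 ∨ p = 0
  · have hz : ∀ t : ℝ, w * (p ^ 2 / (q + t * p)) = 0 := by
      intro t; rcases h0 with h0 | h0 <;> simp [h0]
    have hz2 : w * p = 0 := by rcases h0 with h0 | h0 <;> simp [h0]
    simp only [hz, hz2]
    refine ⟨fun T _ => by simp, ?_⟩
    have : w * (p * (Real.log p - Real.log q)) = 0 := by rw [← mul_assoc, hz2, zero_mul]
    rw [this]; simp
  · push Not at h0
    have hq : 0 < q := by tauto
    have hp : 0 < p := lt_of_le_of_ne hp (Ne.symm h0.2)
    have hpos : ∀ t : ℝ, 0 ≤ t → 0 < q + t * p := fun t ht => by positivity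
    have hd : ∀ T : ℝ, 0 ≤ T → ∀ t ∈ Set.uIcc 0 T,
        HasDerivAt (fun t => w * (p * Real.log (q + t * p))) (w * (p ^ 2 / (q + t * p))) t := by
      intro T hT t ht
      rw [Set.uIcc_of_le hT] at ht
      have h1 : HasDerivAt (fun t : ℝ => q + t * p) p t := by
        simpa using ((hasDerivAt_id t).mul_const p).const_add q
      have h2 := ((h1.log (hpos t ht.1).ne').const_mul p).const_mul w
      exact h2.congr_deriv (by ring)
    have hi : ∀ T : ℝ, 0 ≤ T →
        IntervalIntegrable (fun t => w * (p ^ 2 / (q + t * p))) volume 0 T := by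
      intro T hT
      apply ContinuousOn.intervalIntegrable
      rw [Set.uIcc_of_le hT]
      apply ContinuousOn.mul continuousOn_const
      apply ContinuousOn.div continuousOn_const (by fun_prop)
      intro t ht
      exact (hpos t ht.1).ne'
    refine ⟨hi, ?_⟩
    have hlim : Tendsto (fun T : ℝ => (q + T * p) / (1 + T)) atTop (𝓝 p) := by
      have h1 : Tendsto (fun T : ℝ => p + (q - p) * (1 + T)⁻¹) atTop (𝓝 (p + (q - p) * 0)) := by
        refine tendsto_const_nhds.add (tendsto_const_nhds.mul ?_)
        exact tendsto_inv_atTop_zero.comp (tendsto_atTop_add_const_left _ _ tendsto_id)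
      rw [mul_zero, add_zero] at h1
      refine h1.congr' ?_
      filter_upwards [eventually_ge_atTop 0] with T hT
      have : (1 + T) ≠ 0 := by positivity
      field_simp
      ring
    have hlog := (hlim.log hp.ne').sub_const (Real.log q)
    have h3 := (hlog.const_mul p).const_mul w
    refine h3.congr' ?_
    filter_upwards [eventually_ge_atTop 0] with T hT
    rw [intervalIntegral.integral_eq_sub_of_hasDerivAt (hd T hT) (hi T hT),
      Real.log_div (hpos T hT).ne' (by positivity)]
    simp only [zero_mul, add_zero]
    ring

theorem supp_spec {n : Type*} [Fintype n] [DecidableEq n] (U V : Matrix n n ℂ)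
    (hU : Uᴴ * U = 1) (hV : Vᴴ * V = 1) (p q : n → ℝ) (hq : ∀ i, 0 ≤ q i)
    (hs : suppLe (U * rdiag p * Uᴴ) (V * rdiag q * Vᴴ)) (i j : n) :
    Complex.normSq ((Vᴴ * U) j i) = 0 ∨ p i = 0 ∨ 0 < q j := by
  rcases (hq j).eq_or_lt with h0 | h0
  swap
  · exact Or.inr (Or.inr h0)
  have h1 : (V * rdiag q * Vᴴ) *ᵥ (V *ᵥ Pi.single j 1) = 0 := by
    rw [mulVec_mulVec, Matrix.mul_assoc, hV, Matrix.mul_one, ← mulVec_mulVec]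
    have : rdiag q *ᵥ Pi.single j 1 = 0 := by
      ext k
      by_cases hk : k = j
      · subst hk; simp [rdiag, ← h0]
      · simp [rdiag, hk]
    rw [this, mulVec_zero]
  have h2 := hs _ h1
  have h3 : (rdiag p * (Vᴴ * U)ᴴ) *ᵥ Pi.single j 1 = 0 := by
    have : Uᴴ *ᵥ ((U * rdiag p * Uᴴ) *ᵥ (V *ᵥ Pi.single j 1)) = 0 := by rw [h2, mulVec_zero]
    rw [mulVec_mulVec, mulVec_mulVec] at this
    rw [← this]
    congr 1
    rw [conjTranspose_mul, conjTranspose_conjTranspose]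
    simp only [← Matrix.mul_assoc]
    rw [hU, Matrix.one_mul]
  have h4 := congrFun h3 i
  simp only [mulVec_single_one, col_apply, rdiag, diagonal_mul, conjTranspose_apply, Pi.zero_apply,
    mul_eq_zero] at h4
  rcases h4 with h4 | h4
  · right; left; exact_mod_cast h4
  · left
    rw [Complex.normSq_eq_zero]
    exact star_eq_zero.mp h4

theorem ii_sum {n : Type*} [Fintype n] (f : n → ℝ → ℝ) (T : ℝ)
    (h : ∀ i, IntervalIntegrable (f i) volume 0 T) :
    IntervalIntegrable (fun t => ∑ i, f i t) volume 0 T := by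
  have e : (fun t => ∑ i, f i t) = ∑ i, f i := by funext t; simp
  rw [e]
  exact IntervalIntegrable.sum _ (fun i _ => h i)

theorem exists_Q {n : Type*} [Fintype n] [DecidableEq n] (ρ σ : Matrix n n ℂ)
    (hρ : ρ.PosSemidef) (hσ : σ.PosSemidef) (hs : suppLe ρ σ) :
    ∃ Q : ℝ → ℝ, (∀ t, 0 < t → (∀ X, Fv t ρ σ X ≤ Q t) ∧ ∃ X, Fv t ρ σ X = Q t) ∧
      (∀ T : ℝ, 0 ≤ T → IntervalIntegrable Q volume 0 T) ∧
      Tendsto (fun T => (∫ t in (0 : ℝ)..T, Q t) - ρ.trace.re * Real.log (1 + T)) atTop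
        (𝓝 (Dr ρ σ * Real.log 2)) := by
  obtain ⟨U, p, hU, hp, rfl⟩ : ∃ (U : Matrix n n ℂ) (p : n → ℝ), Uᴴ * U = 1 ∧ (∀ i, 0 ≤ p i) ∧
      ρ = U * rdiag p * Uᴴ :=
    ⟨_, _, eig_unitary hρ.1, hρ.eigenvalues_nonneg, exists_spec hρ.1⟩
  obtain ⟨V, q, hV, hq, rfl⟩ : ∃ (U : Matrix n n ℂ) (p : n → ℝ), Uᴴ * U = 1 ∧ (∀ i, 0 ≤ p i) ∧
      σ = U * rdiag p * Uᴴ :=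
    ⟨_, _, eig_unitary hσ.1, hσ.eigenvalues_nonneg, exists_spec hσ.1⟩
  have hV' : V * Vᴴ = 1 := mul_eq_one_comm.mp hV
  have hW : (Vᴴ * U)ᴴ * (Vᴴ * U) = 1 := by
    rw [conjTranspose_mul, conjTranspose_conjTranspose, Matrix.mul_assoc, ← Matrix.mul_assoc V, hV',
      Matrix.one_mul, hU]
  have key := fun i j => term_lim (Complex.normSq ((Vᴴ * U) j i)) (p i) (q j) (hp i)
    (supp_spec U V hU hV p q hq hs i j)
  refine ⟨fun t => Qs t (Vᴴ * U) p q, fun t ht => ⟨fun X => Fv_le U V hU hV p q hp hq t ht X,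
    Fv_attain U V hU hV p q hp hq t ht⟩, ?_, ?_⟩
  · intro T hT
    unfold Qs
    exact ii_sum _ _ fun i => ii_sum _ _ fun j => (key i j).1 T hT
  · have hl := tendsto_finsetSum (Finset.univ : Finset n)
      (fun i _ => tendsto_finsetSum (Finset.univ : Finset n) (fun j _ => (key i j).2))
    have e1 : Dr (U * rdiag p * Uᴴ) (V * rdiag q * Vᴴ) * Real.log 2 =
        ∑ i, ∑ j, Complex.normSq ((Vᴴ * U) j i) * (p i * (Real.log (p i) - Real.log (q j))) := by
      rw [Dr_spec U V hU hV, Finset.sum_mul]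
      refine Finset.sum_congr rfl fun i _ => ?_
      rw [Finset.sum_mul]
      refine Finset.sum_congr rfl fun j _ => ?_
      have : Real.log 2 ≠ 0 := by positivity
      unfold Real.logb
      field_simp
    rw [e1]
    refine hl.congr' ?_
    filter_upwards [eventually_ge_atTop 0] with T hT
    have e2 : (U * rdiag p * Uᴴ).trace.re
        = ∑ i, ∑ j, Complex.normSq ((Vᴴ * U) j i) * p i := by
      rw [trace_spec U hU, Complex.ofReal_re]
      refine Finset.sum_congr rfl fun i _ => ?_
      rw [← Finset.sum_mul, sum_normSq_row _ hW, one_mul]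
    rw [e2]
    unfold Qs
    rw [intervalIntegral.integral_finsetSum]
    · simp only [Finset.sum_mul, Finset.sum_sub_distrib]
      congr 1
      refine Finset.sum_congr rfl fun i _ => ?_
      rw [intervalIntegral.integral_finsetSum]
      intro j _
      exact (key i j).1 T hT
    · intro i _
      exact ii_sum _ _ fun j => (key i j).1 T hT

/-- core comparison principle -/
theorem core {n m k : Type*} [Fintype n] [DecidableEq n] [Fintype m] [DecidableEq m]
    [Fintype k] [DecidableEq k] (ρ σ : Matrix n n ℂ) (ρ₁ σ₁ : Matrix m m ℂ) (ρ₂ σ₂ : Matrix k k ℂ)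
    (hρ : ρ.PosSemidef) (hσ : σ.PosSemidef) (hs : suppLe ρ σ)
    (hρ₁ : ρ₁.PosSemidef) (hσ₁ : σ₁.PosSemidef) (hs₁ : suppLe ρ₁ σ₁)
    (hρ₂ : ρ₂.PosSemidef) (hσ₂ : σ₂.PosSemidef) (hs₂ : suppLe ρ₂ σ₂)
    (htr : ρ.trace.re = ρ₁.trace.re + ρ₂.trace.re)
    (H : ∀ t, 0 < t → ∀ Y, ∃ X₁ X₂, Fv t ρ σ Y ≤ Fv t ρ₁ σ₁ X₁ + Fv t ρ₂ σ₂ X₂) :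
    Dr ρ σ ≤ Dr ρ₁ σ₁ + Dr ρ₂ σ₂ := by
  obtain ⟨Q, hQ, hi, hl⟩ := exists_Q ρ σ hρ hσ hs
  obtain ⟨Q₁, hQ₁, hi₁, hl₁⟩ := exists_Q ρ₁ σ₁ hρ₁ hσ₁ hs₁
  obtain ⟨Q₂, hQ₂, hi₂, hl₂⟩ := exists_Q ρ₂ σ₂ hρ₂ hσ₂ hs₂
  have h2 : 0 < Real.log 2 := Real.log_pos (by norm_num)
  have hle : ∀ t, 0 < t → Q t ≤ Q₁ t + Q₂ t := by
    intro t ht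
    obtain ⟨Y, hY⟩ := (hQ t ht).2
    obtain ⟨X₁, X₂, hX⟩ := H t ht Y
    have a := (hQ₁ t ht).1 X₁
    have b := (hQ₂ t ht).1 X₂
    linarith
  have : Dr ρ σ * Real.log 2 ≤ Dr ρ₁ σ₁ * Real.log 2 + Dr ρ₂ σ₂ * Real.log 2 := by
    refine le_of_tendsto_of_tendsto hl (hl₁.add hl₂) ?_
    filter_upwards [eventually_ge_atTop 0] with T hT
    have h3 : (∫ t in (0 : ℝ)..T, Q t) ≤ ∫ t in (0 : ℝ)..T, (Q₁ t + Q₂ t) :=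
      intervalIntegral.integral_mono_on_of_le_Ioo hT (hi T hT) ((hi₁ T hT).add (hi₂ T hT))
        (fun t ht => hle t ht.1)
    rw [intervalIntegral.integral_add (hi₁ T hT) (hi₂ T hT)] at h3
    rw [htr]
    nlinarith
  nlinarith

theorem suppLe_refl {n : Type*} [Fintype n] (ρ : Matrix n n ℂ) : suppLe ρ ρ :=
  fun _ h => h

theorem Dr_self {n : Type*} [Fintype n] [DecidableEq n] (ρ : Matrix n n ℂ) : Dr ρ ρ = 0 := by
  simp [Dr]

/-- single version of the core comparison -/
theorem core1 {n m : Type*} [Fintype n] [DecidableEq n] [Fintype m] [DecidableEq m]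
    (ρ σ : Matrix n n ℂ) (ρ₁ σ₁ : Matrix m m ℂ)
    (hρ : ρ.PosSemidef) (hσ : σ.PosSemidef) (hs : suppLe ρ σ)
    (hρ₁ : ρ₁.PosSemidef) (hσ₁ : σ₁.PosSemidef) (hs₁ : suppLe ρ₁ σ₁)
    (htr : ρ.trace.re = ρ₁.trace.re)
    (H : ∀ t, 0 < t → ∀ Y, ∃ X₁, Fv t ρ σ Y ≤ Fv t ρ₁ σ₁ X₁) :
    Dr ρ σ ≤ Dr ρ₁ σ₁ := by
  have := core ρ σ ρ₁ σ₁ (0 : Matrix m m ℂ) 0 hρ hσ hs hρ₁ hσ₁ hs₁ .zero .zero (suppLe_refl _)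
    (by simpa using htr) (fun t ht Y => by
      obtain ⟨X, hX⟩ := H t ht Y
      exact ⟨X, 0, by simpa [Fv] using hX⟩)
  rwa [Dr_self, add_zero] at this

end QIT

namespace QIT
open Matrix

theorem tr_XX_nonneg {n : Type*} [Fintype n] {S : Matrix n n ℂ} (hS : S.PosSemidef)
    (X : Matrix n n ℂ) : 0 ≤ (X * Xᴴ * S).trace.re := by
  have h := (hS.conjTranspose_mul_mul_same X).trace_nonneg
  have e : (X * Xᴴ * S).trace = (Xᴴ * S * X).trace := by
    rw [Matrix.mul_assoc, Matrix.trace_mul_comm]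
  rw [e]
  exact (Complex.le_def.mp h).1

theorem Dr_anti {n : Type*} [Fintype n] [DecidableEq n] (ρ σ σ' : Matrix n n ℂ)
    (hρ : ρ.PosSemidef) (hσ : σ.PosSemidef) (hσ' : σ'.PosSemidef) (hs : suppLe ρ σ)
    (hs' : suppLe ρ σ') (h : (σ' - σ).PosSemidef) : Dr ρ σ' ≤ Dr ρ σ := by
  refine core1 ρ σ' ρ σ hρ hσ' hs' hρ hσ hs rfl (fun t _ Y => ⟨Y, ?_⟩)
  have := tr_XX_nonneg h Y
  rw [Matrix.mul_sub, trace_sub, Complex.sub_re] at this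
  unfold Fv
  linarith

theorem suppLe_of_le {n : Type*} [Fintype n] [DecidableEq n] (ρ σ : Matrix n n ℂ) (c : ℂ)
    (hρ : ρ.PosSemidef) (h : (c • σ - ρ).PosSemidef) : suppLe ρ σ := by
  intro v hv
  have h1 := h.dotProduct_mulVec_nonneg v
  have h2 := hρ.dotProduct_mulVec_nonneg v
  rw [sub_mulVec, smul_mulVec, hv, smul_zero, zero_sub, dotProduct_neg] at h1
  have h3 : star v ⬝ᵥ ρ *ᵥ v = 0 := le_antisymm (by simpa using h1) h2
  exact (hρ.dotProduct_mulVec_zero_iff v).mp h3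

theorem Dr_joint {n : Type*} [Fintype n] [DecidableEq n] (ρ σ ρ' σ' : Matrix n n ℂ)
    (hρ : ρ.PosSemidef) (hσ : σ.PosSemidef) (hρ' : ρ'.PosSemidef) (hσ' : σ'.PosSemidef)
    (hs : suppLe ρ σ) (hs' : suppLe ρ' σ') (hs2 : suppLe (ρ + ρ') (σ + σ')) :
    Dr (ρ + ρ') (σ + σ') ≤ Dr ρ σ + Dr ρ' σ' := by
  refine core _ _ ρ σ ρ' σ' (hρ.add hρ') (hσ.add hσ') hs2 hρ hσ hs hρ' hσ' hs' (by simp)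
    (fun t _ Y => ⟨Y, Y, ?_⟩)
  unfold Fv
  simp only [Matrix.mul_add, trace_add, Complex.add_re]
  linarith

theorem Dr_measure {n : Type*} [Fintype n] [DecidableEq n] (ρ σ P : Matrix n n ℂ)
    (hρ : ρ.PosSemidef) (hσ : σ.PosSemidef) (hs : suppLe ρ σ)
    (hP : Pᴴ = P) (hPP : P * P = P) (a b a' b' : ℝ)
    (ha0 : 0 ≤ a) (hb0 : 0 ≤ b) (ha0' : 0 ≤ a') (hb0' : 0 ≤ b')
    (ha : (P * ρ).trace = a) (hb : ((1 - P) * ρ).trace = b)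
    (ha' : (P * σ).trace = a') (hb' : ((1 - P) * σ).trace = b')
    (hsa : a' = 0 → a = 0) (hsb : b' = 0 → b = 0) :
    a * (Real.logb 2 a - Real.logb 2 a') + b * (Real.logb 2 b - Real.logb 2 b') ≤ Dr ρ σ := by
  have hone : ((1 : Matrix (Fin 2) (Fin 2) ℂ))ᴴ * 1 = 1 := by simp
  have hD := Dr_spec (1 : Matrix (Fin 2) (Fin 2) ℂ) 1 hone hone ![a, b] ![a', b']
  simp only [Fin.sum_univ_two, conjTranspose_one, Matrix.one_mul, Matrix.mul_one] at hD
  simp at hD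
  rw [← hD]
  have hpsd : ∀ x y : ℝ, 0 ≤ x → 0 ≤ y → (rdiag ![x, y]).PosSemidef := by
    intro x y hx hy
    apply PosSemidef.diagonal
    intro i
    fin_cases i <;> simpa
  refine core1 _ _ ρ σ (hpsd _ _ ha0 hb0) (hpsd _ _ ha0' hb0') ?_ hρ hσ hs ?_ ?_
  · intro v hv
    ext i
    have := congrFun hv i
    fin_cases i
    · simp [rdiag, mulVec_diagonal] at this ⊢
      tauto
    · simp [rdiag, mulVec_diagonal] at this ⊢
      tauto
  · have : ρ.trace = a + b := by
      rw [← ha, ← hb, ← trace_add, ← Matrix.add_mul]; simp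
    rw [this]
    simp [rdiag, Fin.sum_univ_two]
  · intro t ht Y
    refine ⟨Y 0 0 • P + Y 1 1 • (1 - P), ?_⟩
    set X := Y 0 0 • P + Y 1 1 • (1 - P) with hX
    have hPQ : P * (1 - P) = 0 := by rw [Matrix.mul_sub, hPP]; simp
    have hQP : (1 - P) * P = 0 := by rw [Matrix.sub_mul, hPP]; simp
    have hQQ : (1 - P) * (1 - P) = 1 - P := by rw [Matrix.mul_sub, hQP]; simp
    have hXs : Xᴴ = star (Y 0 0) • P + star (Y 1 1) • (1 - P) := by
      rw [hX, conjTranspose_add, conjTranspose_smul, conjTranspose_smul, conjTranspose_sub, hP,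
        conjTranspose_one]
    have e1 : (X * ρ).trace = Y 0 0 * a + Y 1 1 * b := by
      rw [hX, Matrix.add_mul, trace_add, Matrix.smul_mul, Matrix.smul_mul, trace_smul, trace_smul,
        ha, hb]; rfl
    have e2 : X * Xᴴ = (Complex.normSq (Y 0 0) : ℂ) • P + (Complex.normSq (Y 1 1) : ℂ) • (1 - P) := by
      rw [hXs, hX]
      simp only [Matrix.add_mul, Matrix.mul_add, Matrix.smul_mul, Matrix.mul_smul, hPP, hPQ, hQP, hQQ,
        smul_zero, add_zero, zero_add, smul_smul, RCLike.star_def, Complex.normSq_eq_conj_mul_self]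
    have e3 : Xᴴ * X = (Complex.normSq (Y 0 0) : ℂ) • P + (Complex.normSq (Y 1 1) : ℂ) • (1 - P) := by
      rw [hXs, hX]
      simp only [Matrix.add_mul, Matrix.mul_add, Matrix.smul_mul, Matrix.mul_smul, hPP, hPQ, hQP, hQQ,
        smul_zero, add_zero, zero_add, smul_smul, RCLike.star_def, Complex.normSq_eq_conj_mul_self,
        mul_comm]
    have e4 : (X * Xᴴ * σ).trace = Complex.normSq (Y 0 0) * a' + Complex.normSq (Y 1 1) * b' := by
      rw [e2, Matrix.add_mul, trace_add, Matrix.smul_mul, Matrix.smul_mul, trace_smul, trace_smul,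
        ha', hb']; rfl
    have e5 : (Xᴴ * X * ρ).trace = Complex.normSq (Y 0 0) * a + Complex.normSq (Y 1 1) * b := by
      rw [e3, Matrix.add_mul, trace_add, Matrix.smul_mul, Matrix.smul_mul, trace_smul, trace_smul,
        ha, hb]; rfl
    have f1 : (Y * rdiag ![a, b]).trace.re = (Y 0 0).re * a + (Y 1 1).re * b := by
      simp [trace, Fin.sum_univ_two, rdiag]
    have f2 : (Y * Yᴴ * rdiag ![a', b']).trace.re =
        (Complex.normSq (Y 0 0) + Complex.normSq (Y 0 1)) * a'
        + (Complex.normSq (Y 1 0) + Complex.normSq (Y 1 1)) * b' := by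
      simp [trace, Fin.sum_univ_two, rdiag, Matrix.mul_apply, Complex.normSq_apply]
    have f3 : (Yᴴ * Y * rdiag ![a, b]).trace.re =
        (Complex.normSq (Y 0 0) + Complex.normSq (Y 1 0)) * a
        + (Complex.normSq (Y 0 1) + Complex.normSq (Y 1 1)) * b := by
      simp [trace, Fin.sum_univ_two, rdiag, Matrix.mul_apply, Complex.normSq_apply]
    unfold Fv
    rw [e1, e4, e5, f1, f2, f3]
    simp only [Complex.add_re, Complex.re_mul_ofReal, Complex.ofReal_re]
    have g1 := mul_nonneg (Complex.normSq_nonneg (Y 0 1)) ha0'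
    have g2 := mul_nonneg (Complex.normSq_nonneg (Y 1 0)) hb0'
    have g3 := mul_nonneg ht.le (mul_nonneg (Complex.normSq_nonneg (Y 1 0)) ha0)
    have g4 := mul_nonneg ht.le (mul_nonneg (Complex.normSq_nonneg (Y 0 1)) hb0)
    linarith

theorem proj_trace {n : Type*} [Fintype n] [DecidableEq n] (ρ P : Matrix n n ℂ)
    (hρ : ρ.PosSemidef) (hP : Pᴴ = P) (hPP : P * P = P) :
    0 ≤ (P * ρ).trace := by
  have h := (hρ.conjTranspose_mul_mul_same P).trace_nonneg
  rwa [hP, Matrix.trace_mul_comm, ← Matrix.mul_assoc, hPP] at h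

theorem proj_supp {n : Type*} [Fintype n] [DecidableEq n] (ρ σ P : Matrix n n ℂ)
    (hσ : σ.PosSemidef) (hs : suppLe ρ σ) (hP : Pᴴ = P) (hPP : P * P = P)
    (h0 : (P * σ).trace = 0) : (P * ρ).trace = 0 := by
  have h1 := hσ.conjTranspose_mul_mul_same P
  have h2 : (Pᴴ * σ * P).trace = 0 := by
    rw [hP, Matrix.trace_mul_comm, ← Matrix.mul_assoc, hPP, h0]
  rw [h1.trace_eq_zero_iff] at h2
  have h3 : ρ * P = 0 := by
    ext i j
    have h4 : σ *ᵥ (P *ᵥ Pi.single j 1) = 0 := by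
      rw [← hσ.dotProduct_mulVec_zero_iff, star_mulVec, ← dotProduct_mulVec, mulVec_mulVec,
        mulVec_mulVec, h2]
      simp
    have h5 := congrFun (hs _ h4) i
    rw [mulVec_mulVec] at h5
    simpa using h5
  rw [Matrix.trace_mul_comm, h3, trace_zero]

/-- binary data processing for a projective measurement -/
theorem Dr_proj {n : Type*} [Fintype n] [DecidableEq n] (ρ σ P : Matrix n n ℂ)
    (hρ : ρ.PosSemidef) (hσ : σ.PosSemidef) (hs : suppLe ρ σ)
    (hP : Pᴴ = P) (hPP : P * P = P) :
    ∃ a b a' b' : ℝ, 0 ≤ a ∧ 0 ≤ b ∧ 0 ≤ a' ∧ 0 ≤ b' ∧ (P * ρ).trace = a ∧ ((1 - P) * ρ).trace = b ∧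
     (P * σ).trace = a' ∧ ((1 - P) * σ).trace = b' ∧ (a' = 0 → a = 0) ∧ (b' = 0 → b = 0) ∧
     a * (Real.logb 2 a - Real.logb 2 a') + b * (Real.logb 2 b - Real.logb 2 b') ≤ Dr ρ σ := by
  have hQ : (1 - P)ᴴ = 1 - P := by rw [conjTranspose_sub, hP, conjTranspose_one]
  have hQQ : (1 - P) * (1 - P) = 1 - P := by
    simp [Matrix.mul_sub, Matrix.sub_mul, hPP]
  have key : ∀ z : ℂ, 0 ≤ z → 0 ≤ z.re ∧ z = (z.re : ℂ) := by
    intro z hz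
    have := Complex.le_def.mp hz
    exact ⟨this.1, Complex.ext rfl (by simpa using this.2.symm)⟩
  have h1 := key _ (proj_trace ρ P hρ hP hPP)
  have h2 := key _ (proj_trace ρ (1 - P) hρ hQ hQQ)
  have h3 := key _ (proj_trace σ P hσ hP hPP)
  have h4 := key _ (proj_trace σ (1 - P) hσ hQ hQQ)
  have hz1 : (P * σ).trace.re = 0 → (P * ρ).trace.re = 0 := by
    intro h
    rw [proj_supp ρ σ P hσ hs hP hPP (by rw [h3.2, h]; simp)]; simp
  have hz2 : ((1 - P) * σ).trace.re = 0 → ((1 - P) * ρ).trace.re = 0 := by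
    intro h
    rw [proj_supp ρ σ (1 - P) hσ hs hQ hQQ (by rw [h4.2, h]; simp)]; simp
  exact ⟨_, _, _, _, h1.1, h2.1, h3.1, h4.1, h1.2, h2.2, h3.2, h4.2, hz1, hz2,
    Dr_measure ρ σ P hρ hσ hs hP hPP _ _ _ _ h1.1 h2.1 h3.1 h4.1 h1.2 h2.2 h3.2 h4.2 hz1 hz2⟩

/-- Klein inequality -/
theorem Dr_klein {n : Type*} [Fintype n] [DecidableEq n] (ρ σ : Matrix n n ℂ)
    (hρ : ρ.PosSemidef) (hσ : σ.PosSemidef) (hs : suppLe ρ σ) :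
    ρ.trace.re * (Real.logb 2 ρ.trace.re - Real.logb 2 σ.trace.re) ≤ Dr ρ σ := by
  obtain ⟨a, b, a', b', _, _, _, _, ha, hb, ha', hb', _, _, h⟩ :=
    Dr_proj ρ σ 1 hρ hσ hs (by simp) (by simp)
  simp only [Matrix.one_mul] at ha ha'
  simp only [sub_self, Matrix.zero_mul, trace_zero] at hb hb'
  have : b = 0 := by exact_mod_cast hb.symm
  rw [ha, ha', Complex.ofReal_re, Complex.ofReal_re]
  simpa [this] using h

end QIT

namespace QIT
open Matrix Kronecker

theorem vN_eq {n : Type*} [Fintype n] [DecidableEq n] (ρ : Matrix n n ℂ) (h : ρ.IsHermitian) :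
    vN ρ = -(ρ * matLog ρ).trace.re := by
  rw [vN, dif_pos h]
  have hU := eig_unitary h
  have e := exists_spec h
  generalize h.eigenvalues = p at e
  generalize (h.eigenvectorUnitary : Matrix n n ℂ) = U at e hU
  subst e
  rw [matLog_spec U hU]
  have : U * rdiag p * Uᴴ * (U * rdiag (fun i => Real.logb 2 (p i)) * Uᴴ)
      = U * rdiag (fun i => p i * Real.logb 2 (p i)) * Uᴴ := by
    calc _ = U * rdiag p * (Uᴴ * U) * rdiag (fun i => Real.logb 2 (p i)) * Uᴴ := by
          simp only [Matrix.mul_assoc]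
      _ = _ := by
        rw [hU, Matrix.mul_one, Matrix.mul_assoc U]
        congr 2
        simp [rdiag, diagonal_mul_diagonal]
  rw [this, trace_spec U hU, Complex.ofReal_re]
  congr 1
  refine Finset.sum_congr rfl fun i _ => ?_
  unfold xlog
  split_ifs with h0 <;> simp [h0]

theorem Dr_eq {n : Type*} [Fintype n] [DecidableEq n] (ρ σ : Matrix n n ℂ) (h : ρ.IsHermitian) :
    Dr ρ σ = -vN ρ - (ρ * matLog σ).trace.re := by
  rw [Dr, Matrix.mul_sub, trace_sub, Complex.sub_re, vN_eq ρ h, neg_neg]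

theorem matLog_kron {A E : Type*} [Fintype A] [DecidableEq A] [Fintype E] [DecidableEq E]
    (τ : Matrix E E ℂ) (h : τ.IsHermitian) :
    matLog ((1 : Matrix A A ℂ) ⊗ₖ τ) = (1 : Matrix A A ℂ) ⊗ₖ matLog τ := by
  have hU := eig_unitary h
  have e := exists_spec h
  generalize h.eigenvalues = p at e
  generalize (h.eigenvectorUnitary : Matrix E E ℂ) = U at e hU
  subst e
  have hk : ∀ f : E → ℝ, (1 : Matrix A A ℂ) ⊗ₖ (U * rdiag f * Uᴴ)
      = ((1 : Matrix A A ℂ) ⊗ₖ U) * rdiag (fun x : A × E => f x.2) * ((1 : Matrix A A ℂ) ⊗ₖ U)ᴴ := by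
    intro f
    have : rdiag (fun x : A × E => f x.2) = (1 : Matrix A A ℂ) ⊗ₖ rdiag f := by
      unfold rdiag
      rw [← diagonal_one, diagonal_kronecker_diagonal]
      simp
    rw [this, conjTranspose_kronecker, conjTranspose_one, ← mul_kronecker_mul, ← mul_kronecker_mul]
    simp
  rw [matLog_spec U hU, hk, hk, matLog_spec]
  rw [conjTranspose_kronecker, conjTranspose_one, ← mul_kronecker_mul, hU]
  simp

theorem trace_kron {A E : Type*} [Fintype A] [DecidableEq A] [Fintype E] [DecidableEq E]
    (X : Matrix (A × E) (A × E) ℂ) (L : Matrix E E ℂ) :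
    (X * ((1 : Matrix A A ℂ) ⊗ₖ L)).trace = (ptrFst X * L).trace := by
  simp only [trace, diag, Matrix.mul_apply, kroneckerMap_apply, ptrFst, of_apply,
    Fintype.sum_prod_type, one_apply, ite_mul, one_mul, zero_mul, mul_ite, mul_zero, Finset.sum_mul]
  have h1 : ∀ (a : A) (e : E), ∑ a', ∑ e', (if a' = a then X (a, e) (a', e') * L e' e else 0)
      = ∑ e', X (a, e) (a, e') * L e' e := by
    intro a e
    rw [Finset.sum_eq_single a]
    · simp
    · intro b _ hb; simp [hb]
    · simp
  simp only [h1]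
  rw [Finset.sum_comm]
  refine Finset.sum_congr rfl fun e _ => ?_
  rw [Finset.sum_comm]

theorem ptrFst_psd {A E : Type*} [Fintype A] [Fintype E]
    {X : Matrix (A × E) (A × E) ℂ} (hX : X.PosSemidef) : (ptrFst X).PosSemidef := by
  have : ptrFst X = ∑ a, X.submatrix (fun e => (a, e)) (fun e => (a, e)) := by
    ext i j
    simp [ptrFst, Matrix.sum_apply]
  rw [this]
  exact posSemidef_sum _ fun a _ => hX.submatrix _

theorem kron_psd {A E : Type*} [Fintype A] [DecidableEq A] [Fintype E] [DecidableEq E]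
    {τ : Matrix E E ℂ} (h : τ.PosSemidef) : ((1 : Matrix A A ℂ) ⊗ₖ τ).PosSemidef :=
  PosSemidef.kronecker .one h

theorem trace_ptrFst {A E : Type*} [Fintype A] [Fintype E]
    (X : Matrix (A × E) (A × E) ℂ) : (ptrFst X).trace = X.trace := by
  simp only [trace, diag, ptrFst, of_apply, Fintype.sum_prod_type]
  rw [Finset.sum_comm]

/-- matrix unit tensor identity -/
def Sab {A E : Type*} [DecidableEq A] [DecidableEq E] (a b : A) : Matrix (A × E) (A × E) ℂ :=
  Matrix.of fun x y => if x.1 = b then (if y.1 = a then (if x.2 = y.2 then 1 else 0) else 0) else 0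

theorem Sab_conj {A E : Type*} [Fintype A] [DecidableEq A] [Fintype E] [DecidableEq E]
    (X : Matrix (A × E) (A × E) ℂ) (a b : A) (x y : A × E) :
    ((Sab a b)ᴴ * X * Sab a b : Matrix (A × E) (A × E) ℂ) x y =
      if x.1 = a then (if y.1 = a then X (b, x.2) (b, y.2) else 0) else 0 := by
  simp only [Matrix.mul_apply, Sab, conjTranspose_apply, of_apply, Fintype.sum_prod_type]
  by_cases hx : x.1 = a <;> by_cases hy : y.1 = a <;>
    simp [hx, hy, apply_ite star, Finset.sum_ite_eq, ite_mul]

theorem Sab_sum {A E : Type*} [Fintype A] [DecidableEq A] [Fintype E] [DecidableEq E] :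
    ∑ a : A, (Sab a a : Matrix (A × E) (A × E) ℂ) = 1 := by
  ext x y
  rw [Matrix.sum_apply]
  simp only [Sab, of_apply, Finset.sum_ite_eq, Finset.mem_univ, if_true, one_apply, Prod.ext_iff]
  by_cases h1 : x.1 = y.1 <;> by_cases h2 : x.2 = y.2 <;> simp [h1, h2, eq_comm]

theorem Sab_herm {A E : Type*} [DecidableEq A] [DecidableEq E] (a : A) :
    (Sab a a : Matrix (A × E) (A × E) ℂ)ᴴ = Sab a a := by
  ext x y
  simp only [Sab, conjTranspose_apply, of_apply]
  by_cases h1 : x.1 = a <;> by_cases h2 : y.1 = a <;> by_cases h3 : x.2 = y.2 <;>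
    simp [h1, h2, h3, eq_comm]

theorem kron_eq_sum {A E : Type*} [Fintype A] [DecidableEq A] [Fintype E] [DecidableEq E]
    (X : Matrix (A × E) (A × E) ℂ) :
    (1 : Matrix A A ℂ) ⊗ₖ ptrFst X = ∑ a, ∑ b, (Sab a b)ᴴ * X * Sab a b := by
  ext x y
  simp only [Matrix.sum_apply, Sab_conj, kroneckerMap_apply, ptrFst, of_apply, one_apply]
  by_cases h : x.1 = y.1
  · rw [if_pos h, one_mul, Finset.sum_comm]
    refine Finset.sum_congr rfl fun b _ => ?_
    simp [h]
  · rw [if_neg h, zero_mul]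
    symm
    refine Finset.sum_eq_zero fun a _ => Finset.sum_eq_zero fun b _ => ?_
    by_cases hx : x.1 = a
    · have : y.1 ≠ a := fun hy => h (hx.trans hy.symm)
      simp [this]
    · simp [hx]

/-- `X ≤ d · 1 ⊗ X_E` -/
theorem le_kron {A E : Type*} [Fintype A] [DecidableEq A] [Fintype E] [DecidableEq E]
    {X : Matrix (A × E) (A × E) ℂ} (hX : X.PosSemidef) :
    (((Fintype.card A : ℂ)) • ((1 : Matrix A A ℂ) ⊗ₖ ptrFst X) - X).PosSemidef := by
  set K : A → Matrix (A × E) (A × E) ℂ := fun a => Sab a a with hK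
  have h1 : ((1 : Matrix A A ℂ) ⊗ₖ ptrFst X - ∑ a, K a * X * K a).PosSemidef := by
    rw [kron_eq_sum, ← Finset.sum_sub_distrib]
    refine posSemidef_sum _ fun a _ => ?_
    rw [← Finset.add_sum_erase _ _ (Finset.mem_univ a), Sab_herm, add_sub_cancel_left]
    exact posSemidef_sum _ fun b _ => hX.conjTranspose_mul_mul_same _
  have h2 : ((Fintype.card A : ℂ) • ∑ a, K a * X * K a - X).PosSemidef := by
    have e : (Fintype.card A : ℂ) • ∑ a, K a * X * K a - X
        = (1 / 2 : ℂ) • ∑ a, ∑ b, (K a - K b)ᴴ * X * (K a - K b) := by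
      have hX2 : X = ∑ a, ∑ b, K a * X * K b := by
        calc X = (∑ a, K a) * X * (∑ b, K b) := by rw [Sab_sum]; simp
          _ = _ := by
            rw [Finset.sum_mul, Finset.sum_mul]
            exact Finset.sum_congr rfl fun a _ => by rw [Finset.mul_sum]
      have hX3 : ∑ a, ∑ b, K b * X * K a = X := by rw [Finset.sum_comm]; exact hX2.symm
      have : ∀ a b, (K a - K b)ᴴ * X * (K a - K b)
          = K a * X * K a + K b * X * K b - K a * X * K b - K b * X * K a := by
        intro a b
        rw [conjTranspose_sub, Sab_herm, Sab_herm]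
        simp only [Matrix.sub_mul, Matrix.mul_sub]
        abel
      simp only [this, Finset.sum_sub_distrib, Finset.sum_add_distrib, Finset.sum_const,
        Finset.card_univ]
      rw [← hX2, hX3, ← Finset.smul_sum, ← Nat.cast_smul_eq_nsmul ℂ]
      module
    rw [e]
    refine (posSemidef_sum _ fun a _ => posSemidef_sum _ fun b _ =>
      hX.conjTranspose_mul_mul_same _).smul (by norm_num [Complex.le_def])
  have := (h1.smul (a := (Fintype.card A : ℂ)) (by positivity)).add h2
  convert this using 1
  rw [smul_sub]; abel

end QIT

namespace QIT
open Matrix Kronecker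

/-- conditional entropy `H(A|E)` -/
def cE {A E : Type*} [Fintype A] [DecidableEq A] [Fintype E] [DecidableEq E]
    (X : Matrix (A × E) (A × E) ℂ) : ℝ := vN X - vN (ptrFst X)

theorem supp_kron {A E : Type*} [Fintype A] [DecidableEq A] [Fintype E] [DecidableEq E]
    {X : Matrix (A × E) (A × E) ℂ} (hX : X.PosSemidef) :
    suppLe X ((1 : Matrix A A ℂ) ⊗ₖ ptrFst X) :=
  suppLe_of_le _ _ _ hX (le_kron hX)

theorem Dr_kron {A E : Type*} [Fintype A] [DecidableEq A] [Fintype E] [DecidableEq E]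
    {X : Matrix (A × E) (A × E) ℂ} (hX : X.PosSemidef) :
    Dr X ((1 : Matrix A A ℂ) ⊗ₖ ptrFst X) = -cE X := by
  rw [Dr_eq _ _ hX.1, matLog_kron _ (ptrFst_psd hX).1, trace_kron, cE,
    vN_eq (ptrFst X) (ptrFst_psd hX).1]
  ring

theorem ptrFst_add {A E : Type*} [Fintype A] (X Y : Matrix (A × E) (A × E) ℂ) :
    ptrFst (X + Y) = ptrFst X + ptrFst Y := by
  ext i j; simp [ptrFst, Finset.sum_add_distrib]

theorem cE_super {A E : Type*} [Fintype A] [DecidableEq A] [Fintype E] [DecidableEq E]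
    {X Y : Matrix (A × E) (A × E) ℂ} (hX : X.PosSemidef) (hY : Y.PosSemidef) :
    cE X + cE Y ≤ cE (X + Y) := by
  have h := Dr_joint X ((1 : Matrix A A ℂ) ⊗ₖ ptrFst X) Y ((1 : Matrix A A ℂ) ⊗ₖ ptrFst Y)
    hX (kron_psd (ptrFst_psd hX)) hY (kron_psd (ptrFst_psd hY)) (supp_kron hX) (supp_kron hY)
  rw [← kronecker_add, ← ptrFst_add, Dr_kron hX, Dr_kron hY, Dr_kron (hX.add hY)] at h
  linarith [h (supp_kron (hX.add hY))]

theorem Dr_smul_self {n : Type*} [Fintype n] [DecidableEq n] (ρ : Matrix n n ℂ)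
    (h : ρ.IsHermitian) (c : ℝ) (hc : 0 < c) :
    Dr ρ ((c : ℂ) • ρ) = -(ρ.trace.re * Real.logb 2 c) := by
  have hU := eig_unitary h
  have e := exists_spec h
  generalize h.eigenvalues = p at e
  generalize (h.eigenvectorUnitary : Matrix n n ℂ) = U at e hU
  subst e
  have e2 : (c : ℂ) • (U * rdiag p * Uᴴ) = U * rdiag (fun i => c * p i) * Uᴴ := by
    rw [← Matrix.smul_mul, ← Matrix.mul_smul]
    congr 2
    ext i j
    by_cases hij : i = j <;> simp [rdiag, diagonal, hij]
  rw [e2, Dr_spec U U hU hU, hU, trace_spec U hU, Complex.ofReal_re, Finset.sum_mul,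
    ← Finset.sum_neg_distrib]
  refine Finset.sum_congr rfl fun i _ => ?_
  rw [Finset.sum_eq_single i]
  · rw [one_apply_eq]
    by_cases hp : p i = 0
    · simp [hp]
    · rw [Real.logb_mul hc.ne' hp]; simp
  · intro j _ hj; simp [one_apply_ne hj]
  · simp

theorem trace_kron_one {A E : Type*} [Fintype A] [DecidableEq A] [Fintype E] [DecidableEq E]
    (X : Matrix (A × E) (A × E) ℂ) :
    ((1 : Matrix A A ℂ) ⊗ₖ ptrFst X).trace = Fintype.card A * X.trace := by
  rw [trace_kronecker, trace_one, trace_ptrFst]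

theorem tr_re_nonneg {n : Type*} [Fintype n] {X : Matrix n n ℂ} (hX : X.PosSemidef) :
    0 ≤ X.trace.re := (Complex.le_def.mp hX.trace_nonneg).1

theorem cE_le {A E : Type*} [Fintype A] [DecidableEq A] [Nonempty A] [Fintype E] [DecidableEq E]
    {X : Matrix (A × E) (A × E) ℂ} (hX : X.PosSemidef) :
    cE X ≤ X.trace.re * Real.logb 2 (Fintype.card A) := by
  have h := Dr_klein X _ hX (kron_psd (ptrFst_psd hX)) (supp_kron hX)
  rw [Dr_kron hX, trace_kron_one] at h
  have e : ((Fintype.card A : ℂ) * X.trace).re = Fintype.card A * X.trace.re := by simp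
  rw [e] at h
  have hc : (Fintype.card A : ℝ) ≠ 0 := by simp
  by_cases h0 : X.trace.re = 0
  · rw [h0] at h ⊢; linarith
  · rw [Real.logb_mul hc h0] at h
    linarith

theorem cE_ge {A E : Type*} [Fintype A] [DecidableEq A] [Nonempty A] [Fintype E] [DecidableEq E]
    {X : Matrix (A × E) (A × E) ℂ} (hX : X.PosSemidef) :
    -(X.trace.re * Real.logb 2 (Fintype.card A)) ≤ cE X := by
  have hc : (0 : ℝ) < (Fintype.card A : ℝ) := by simp [Fintype.card_pos]
  set c : ℝ := (Fintype.card A : ℝ)⁻¹ with hcd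
  have hc' : 0 < c := by positivity
  have hcc : (0 : ℂ) ≤ (c : ℂ) := by exact_mod_cast hc'.le
  have hle : ((1 : Matrix A A ℂ) ⊗ₖ ptrFst X - (c : ℂ) • X).PosSemidef := by
    have := (le_kron hX).smul hcc
    rw [smul_sub, smul_smul] at this
    have e : (c : ℂ) * (Fintype.card A : ℂ) = 1 := by
      rw [hcd]; push_cast
      exact inv_mul_cancel₀ (by exact_mod_cast hc.ne')
    rwa [e, one_smul] at this
  have hs : suppLe X ((c : ℂ) • X) := by
    intro v hv
    rw [smul_mulVec] at hv
    rcases smul_eq_zero.mp hv with h | h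
    · exact absurd (by exact_mod_cast h) hc'.ne'
    · exact h
  have h := Dr_anti X ((c : ℂ) • X) _ hX (hX.smul hcc) (kron_psd (ptrFst_psd hX)) hs
    (supp_kron hX) hle
  rw [Dr_kron hX, Dr_smul_self X hX.1 c hc', hcd, Real.logb_inv] at h
  linarith

theorem supp_add {n : Type*} [Fintype n] [DecidableEq n] {X Y : Matrix n n ℂ}
    (hX : X.PosSemidef) (hY : Y.PosSemidef) : suppLe X (X + Y) :=
  suppLe_of_le X (X + Y) 1 hX (by simpa using hY)

theorem vN_sum_eq {n : Type*} [Fintype n] [DecidableEq n] {X Y : Matrix n n ℂ}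
    (hX : X.PosSemidef) (hY : Y.PosSemidef) :
    vN (X + Y) - vN X - vN Y = Dr X (X + Y) + Dr Y (X + Y) := by
  rw [Dr_eq _ _ hX.1, Dr_eq _ _ hY.1, vN_eq _ (hX.add hY).1, Matrix.add_mul, trace_add,
    Complex.add_re]
  ring

theorem vN_sub {n : Type*} [Fintype n] [DecidableEq n] {X Y : Matrix n n ℂ}
    (hX : X.PosSemidef) (hY : Y.PosSemidef) : vN (X + Y) ≤ vN X + vN Y := by
  have h := vN_sum_eq hX hY
  have hYX : suppLe Y (X + Y) := by rw [add_comm]; exact supp_add hY hX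
  have h1 := Dr_anti X X (X + Y) hX hX (hX.add hY) (suppLe_refl _) (supp_add hX hY)
    (by simpa using hY)
  have h2 := Dr_anti Y Y (X + Y) hY hY (hX.add hY) (suppLe_refl _) hYX (by simpa using hX)
  rw [Dr_self] at h1 h2
  linarith

/-- unnormalised binary entropy -/
def gB (x y : ℝ) : ℝ :=
  x * (Real.logb 2 (x + y) - Real.logb 2 x) + y * (Real.logb 2 (x + y) - Real.logb 2 y)

theorem vN_super {n : Type*} [Fintype n] [DecidableEq n] {X Y : Matrix n n ℂ}
    (hX : X.PosSemidef) (hY : Y.PosSemidef) :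
    vN X + vN Y - gB X.trace.re Y.trace.re ≤ vN (X + Y) := by
  have h := vN_sum_eq hX hY
  have hYX : suppLe Y (X + Y) := by rw [add_comm]; exact supp_add hY hX
  have h1 := Dr_klein X (X + Y) hX (hX.add hY) (supp_add hX hY)
  have h2 := Dr_klein Y (X + Y) hY (hX.add hY) hYX
  rw [trace_add, Complex.add_re] at h1 h2
  unfold gB
  linarith

theorem cE_upper {A E : Type*} [Fintype A] [DecidableEq A] [Fintype E] [DecidableEq E]
    {X Y : Matrix (A × E) (A × E) ℂ} (hX : X.PosSemidef) (hY : Y.PosSemidef) :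
    cE (X + Y) ≤ cE X + cE Y + gB X.trace.re Y.trace.re := by
  have h1 := vN_sub hX hY
  have h2 := vN_super (ptrFst_psd hX) (ptrFst_psd hY)
  rw [trace_ptrFst, trace_ptrFst] at h2
  unfold cE
  rw [ptrFst_add]
  linarith

end QIT

namespace QIT
open Matrix Kronecker

theorem cp_general {b b' K : Type*} [Fintype b] [Fintype b'] [Fintype K]
    (R : Matrix b b ℂ →ₗ[ℂ] Matrix b' b' ℂ) (hR : IsCPTP R) (M : Matrix (K × b) (K × b) ℂ)
    (hM : M.PosSemidef) : (tensorId (⇑R) M).PosSemidef := by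
  have e := Fintype.equivFin K
  have h1 := hR.2 _ _ (hM.submatrix (fun x : Fin (Fintype.card K) × b => (e.symm x.1, x.2)))
  have h2 := h1.submatrix (fun x : K × b' => (e x.1, x.2))
  convert h2 using 1
  ext x y
  simp [tensorId]

theorem block_trace {m : Type*} [Fintype m] [DecidableEq m] (M : Matrix (Fin 2 × m) (Fin 2 × m) ℂ)
    (hM : M.PosSemidef) (G : Fin 2 → Fin 2 → Matrix m m ℂ)
    (hG : ∀ s s' u v, M (s, u) (s', v) = G s s' u v) (W : Matrix m m ℂ) :
    0 ≤ (W * Wᴴ * G 0 0).trace.re - (Wᴴ * G 0 1).trace.re - (W * G 1 0).trace.re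
      + (G 1 1).trace.re := by
  let B : Fin 2 → Matrix m m ℂ := ![W, -1]
  let BB : Matrix (Fin 2 × m) m ℂ := Matrix.of fun x j => B x.1 x.2 j
  have h := tr_re_nonneg (hM.conjTranspose_mul_mul_same BB)
  have e : BBᴴ * M * BB = ∑ s', ∑ s, (B s)ᴴ * G s s' * B s' := by
    ext i j
    simp only [Matrix.mul_apply, Matrix.sum_apply, Fintype.sum_prod_type, BB, conjTranspose_apply,
      of_apply, hG, Finset.sum_mul]
    refine Finset.sum_congr rfl fun s' _ => ?_
    rw [Finset.sum_comm]
  rw [e] at h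
  simp only [Fin.sum_univ_two, B, cons_val_zero, cons_val_one, trace_add, Complex.add_re,
    conjTranspose_neg, conjTranspose_one, Matrix.neg_mul, Matrix.mul_neg, Matrix.one_mul,
    Matrix.mul_one, trace_neg, Complex.neg_re, neg_neg] at h
  rw [Matrix.trace_mul_comm (Wᴴ * G 0 0), ← Matrix.mul_assoc, Matrix.trace_mul_comm (G 1 0)] at h
  linarith

/-- Schwarz type inequality for 2-positive trace preserving maps -/
theorem schwarz {n m : Type*} [Fintype n] [DecidableEq n] [Fintype m] [DecidableEq m]
    (Φ : Matrix n n ℂ → Matrix m m ℂ) (htr : ∀ M, (Φ M).trace = M.trace)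
    (h2 : ∀ M : Matrix (Fin 2 × n) (Fin 2 × n) ℂ, M.PosSemidef → (tensorId Φ M).PosSemidef)
    (S : Matrix n n ℂ) (hS : S.PosSemidef) (Z : Matrix n n ℂ) (W : Matrix m m ℂ) :
    (Wᴴ * Φ (S * Z)).trace.re = (W * Φ (Zᴴ * S)).trace.re ∧
    0 ≤ (W * Wᴴ * Φ S).trace.re - (Wᴴ * Φ (S * Z)).trace.re - (W * Φ (Zᴴ * S)).trace.re
      + (Zᴴ * S * Z).trace.re := by
  let C : Fin 2 → Matrix n n ℂ := ![1, Z]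
  let CC : Matrix n (Fin 2 × n) ℂ := Matrix.of fun i x => C x.1 i x.2
  have hN := h2 _ (hS.conjTranspose_mul_mul_same CC)
  have hG : ∀ s s' u v, tensorId Φ (CCᴴ * S * CC) (s, u) (s', v)
      = Φ ((C s)ᴴ * S * C s') u v := by
    intro s s' u v
    rfl
  have hb := block_trace _ hN (fun s s' => Φ ((C s)ᴴ * S * C s')) hG W
  have hh : (Φ (S * Z))ᴴ = Φ (Zᴴ * S) := by
    ext i j
    have := congrFun (congrFun hN.1 (1, i)) (0, j)
    rw [conjTranspose_apply, hG, hG] at this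
    simpa [C] using this
  simp only [C, cons_val_zero, cons_val_one, conjTranspose_one, Matrix.one_mul,
    Matrix.mul_one, htr] at hb
  refine ⟨?_, hb⟩
  rw [← hh, Matrix.trace_mul_comm W, ← conjTranspose_conjTranspose W, ← conjTranspose_mul,
    trace_conjTranspose, conjTranspose_conjTranspose]
  simp

theorem exists_adjoint {n m : Type*} [Fintype n] [DecidableEq n] [Fintype m]
    (Φ : Matrix n n ℂ →ₗ[ℂ] Matrix m m ℂ) (Y : Matrix m m ℂ) :
    ∃ X : Matrix n n ℂ, ∀ N, (X * N).trace = (Y * Φ N).trace := by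
  refine ⟨Matrix.of fun i j => (Y * Φ (single j i 1)).trace, fun N => ?_⟩
  have hN : N = ∑ j, ∑ i, N j i • single j i (1 : ℂ) := by
    conv_lhs => rw [matrix_eq_sum_single N]
    simp [smul_single]
  have : (Y * Φ N).trace = ∑ j, ∑ i, N j i * (Y * Φ (single j i 1)).trace := by
    conv_lhs => rw [hN]
    simp only [map_sum, map_smul, Finset.mul_sum, Matrix.mul_sum, Matrix.mul_smul, trace_sum, trace_smul,
      smul_eq_mul]
  rw [this]
  simp only [trace, diag, Matrix.mul_apply, of_apply]
  rw [Finset.sum_comm]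
  exact Finset.sum_congr rfl fun j _ => Finset.sum_congr rfl fun i _ => mul_comm _ _

/-- data processing inequality -/
theorem Dr_dpi {n m : Type*} [Fintype n] [DecidableEq n] [Fintype m] [DecidableEq m]
    (Φ : Matrix n n ℂ →ₗ[ℂ] Matrix m m ℂ) (htr : ∀ M, (Φ M).trace = M.trace)
    (h2 : ∀ M : Matrix (Fin 2 × n) (Fin 2 × n) ℂ, M.PosSemidef → (tensorId (⇑Φ) M).PosSemidef)
    (ρ σ : Matrix n n ℂ) (hρ : ρ.PosSemidef) (hσ : σ.PosSemidef)
    (hρ' : (Φ ρ).PosSemidef) (hσ' : (Φ σ).PosSemidef)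
    (hs : suppLe ρ σ) (hs' : suppLe (Φ ρ) (Φ σ)) : Dr (Φ ρ) (Φ σ) ≤ Dr ρ σ := by
  refine core1 _ _ ρ σ hρ' hσ' hs' hρ hσ hs (by rw [htr]) (fun t ht Y => ?_)
  obtain ⟨X, hX⟩ := exists_adjoint Φ Y
  refine ⟨X, ?_⟩
  have h1 := schwarz Φ htr h2 σ hσ X Y
  have h3 := schwarz Φ htr h2 ρ hρ Xᴴ Yᴴ
  rw [h1.1, ← hX, ← Matrix.mul_assoc] at h1
  rw [← h3.1, conjTranspose_conjTranspose, conjTranspose_conjTranspose, ← hX] at h3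
  have e1 : (Xᴴ * σ * X).trace = (X * Xᴴ * σ).trace := by
    rw [Matrix.trace_mul_comm, ← Matrix.mul_assoc]
  have e2 : (X * (ρ * Xᴴ)).trace = (Xᴴ * X * ρ).trace := by
    rw [← Matrix.mul_assoc, Matrix.trace_mul_comm, ← Matrix.mul_assoc]
  have e3 : (X * ρ * Xᴴ).trace = (Xᴴ * X * ρ).trace := by
    rw [Matrix.trace_mul_comm, ← Matrix.mul_assoc]
  rw [e1] at h1
  rw [e2, e3] at h3
  have h1' := h1.2
  have h3' := h3.2
  unfold Fv
  rw [hX ρ]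
  nlinarith

/-- `id ⊗ R` as a linear map -/
def tensorLin {A b b' : Type*} (R : Matrix b b ℂ →ₗ[ℂ] Matrix b' b' ℂ) :
    Matrix (A × b) (A × b) ℂ →ₗ[ℂ] Matrix (A × b') (A × b') ℂ where
  toFun := tensorId (⇑R)
  map_add' X Y := by
    ext x y
    have : (Matrix.of fun u v => (X + Y) (x.1, u) (y.1, v))
        = (Matrix.of fun u v => X (x.1, u) (y.1, v)) + Matrix.of fun u v => Y (x.1, u) (y.1, v) := by
      ext; simp
    show R (Matrix.of fun u v => (X + Y) (x.1, u) (y.1, v)) x.2 y.2 = _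
    rw [this, map_add]; rfl
  map_smul' c X := by
    ext x y
    have : (Matrix.of fun u v => (c • X) (x.1, u) (y.1, v))
        = c • (Matrix.of fun u v => X (x.1, u) (y.1, v)) := by
      ext; simp
    show R (Matrix.of fun u v => (c • X) (x.1, u) (y.1, v)) x.2 y.2 = _
    rw [this, map_smul]; rfl

theorem tensorId_trace {A b b' : Type*} [Fintype A] [Fintype b] [Fintype b']
    (R : Matrix b b ℂ →ₗ[ℂ] Matrix b' b' ℂ) (hR : ∀ M, (R M).trace = M.trace)
    (X : Matrix (A × b) (A × b) ℂ) : (tensorId (⇑R) X).trace = X.trace := by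
  simp only [trace, diag, Fintype.sum_prod_type]
  refine Finset.sum_congr rfl fun a _ => ?_
  exact hR (Matrix.of fun u v => X (a, u) (a, v))

theorem ptrFst_tensorId {A b b' : Type*} [Fintype A]
    (R : Matrix b b ℂ →ₗ[ℂ] Matrix b' b' ℂ)
    (X : Matrix (A × b) (A × b) ℂ) : ptrFst (tensorId (⇑R) X) = R (ptrFst X) := by
  have : ptrFst X = ∑ a, Matrix.of fun u v => X (a, u) (a, v) := by
    ext i j; simp [ptrFst, Matrix.sum_apply]
  rw [this, map_sum]
  ext i j
  simp [ptrFst, tensorId, Matrix.sum_apply]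

theorem tensorId_kron {A b b' : Type*} [Fintype A] [DecidableEq A]
    (R : Matrix b b ℂ →ₗ[ℂ] Matrix b' b' ℂ) (τ : Matrix b b ℂ) :
    tensorId (⇑R) ((1 : Matrix A A ℂ) ⊗ₖ τ) = (1 : Matrix A A ℂ) ⊗ₖ R τ := by
  ext x y
  have : (Matrix.of fun u v => ((1 : Matrix A A ℂ) ⊗ₖ τ) (x.1, u) (y.1, v))
      = (1 : Matrix A A ℂ) x.1 y.1 • τ := by
    ext; simp
  show R (Matrix.of fun u v => ((1 : Matrix A A ℂ) ⊗ₖ τ) (x.1, u) (y.1, v)) x.2 y.2 = _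
  rw [this, map_smul, Matrix.smul_apply, kroneckerMap_apply, smul_eq_mul]

theorem cE_dpi {A b b' : Type*} [Fintype A] [DecidableEq A] [Fintype b] [DecidableEq b]
    [Fintype b'] [DecidableEq b'] (R : Matrix b b ℂ →ₗ[ℂ] Matrix b' b' ℂ) (hR : IsCPTP R)
    {X : Matrix (A × b) (A × b) ℂ} (hX : X.PosSemidef) : cE X ≤ cE (tensorId (⇑R) X) := by
  have hX' : (tensorId (⇑R) X).PosSemidef := cp_general R hR X hX
  have e : tensorLin (A := A) R ((1 : Matrix A A ℂ) ⊗ₖ ptrFst X)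
      = (1 : Matrix A A ℂ) ⊗ₖ ptrFst (tensorId (⇑R) X) := by
    rw [ptrFst_tensorId]; exact tensorId_kron R _
  have h := Dr_dpi (tensorLin (A := A) R) (tensorId_trace R hR.1) (by
      intro M hM
      have h1 := cp_general R hR _ (hM.submatrix
        (fun x : (Fin 2 × A) × b => (x.1.1, (x.1.2, x.2))))
      exact h1.submatrix (fun x : Fin 2 × (A × b') => ((x.1, x.2.1), x.2.2)))
    X ((1 : Matrix A A ℂ) ⊗ₖ ptrFst X) hX (kron_psd (ptrFst_psd hX)) hX'
    (by rw [e]; exact kron_psd (ptrFst_psd hX')) (supp_kron hX)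
    (by rw [e]; exact supp_kron hX')
  rw [e, Dr_kron hX] at h
  have h3 : Dr (tensorId (⇑R) X) ((1 : Matrix A A ℂ) ⊗ₖ ptrFst (tensorId (⇑R) X)) ≤ -cE X := h
  rw [Dr_kron hX'] at h3
  linarith

/-- partial trace as a linear map -/
def ptrSndLin {b c : Type*} [Fintype c] : Matrix (b × c) (b × c) ℂ →ₗ[ℂ] Matrix b b ℂ where
  toFun := ptrSnd
  map_add' X Y := by ext i j; simp [ptrSnd, Finset.sum_add_distrib]
  map_smul' r X := by ext i j; simp [ptrSnd, Finset.mul_sum]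

theorem ptrSnd_cptp {b c : Type*} [Fintype b] [Fintype c] :
    IsCPTP (ptrSndLin : Matrix (b × c) (b × c) ℂ →ₗ[ℂ] Matrix b b ℂ) := by
  constructor
  · intro M
    simp [ptrSndLin, ptrSnd, trace, Fintype.sum_prod_type]
  · intro k M hM
    have : tensorId (⇑(ptrSndLin : Matrix (b × c) (b × c) ℂ →ₗ[ℂ] Matrix b b ℂ)) M
        = ∑ z, M.submatrix (fun x : Fin k × b => (x.1, (x.2, z))) (fun x => (x.1, (x.2, z))) := by
      ext i j
      simp [tensorId, ptrSndLin, ptrSnd, Matrix.sum_apply]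
    rw [this]
    exact posSemidef_sum _ fun z _ => hM.submatrix _

end QIT
namespace QIT
section Scalar
open Real
/-- binary Pinsker, interior -/
theorem bp0 {a b : ℝ} (ha : 0 < a) (ha1 : a < 1) (hb : 0 < b) (hb1 : b < 1) :
    2*(a-b)^2 ≤ a*(log a - log b) + (1-a)*(log (1-a) - log (1-b)) := by
  let f : ℝ → ℝ := fun x => a*(log a - log x) + (1-a)*(log (1-a) - log (1-x)) - 2*(a-x)^2
  have hf : ∀ x, 0 < x → x < 1 → HasDerivAt f ((x-a)*(1-2*x)^2/(x*(1-x))) x := by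
    intro x h0 h1
    have h2 : HasDerivAt (fun x : ℝ => 1 - x) (-1) x := by
      simpa using (hasDerivAt_id x).const_sub 1
    have h3 := ((hasDerivAt_log h0.ne').const_sub (log a)).const_mul a
    have h4 := ((h2.log (by linarith)).const_sub (log (1-a))).const_mul (1-a)
    have h5 := ((((hasDerivAt_id x).const_sub a)).pow 2).const_mul 2
    have := (h3.add h4).sub h5
    have h6 : HasDerivAt f _ x := this
    refine h6.congr_deriv ?_
    have : (1-x) ≠ 0 := by linarith
    simp
    field_simp
    ring
  have key : f a ≤ f b := by
    rcases le_total a b with h | h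
    · have hm : MonotoneOn f (Set.Icc a b) := by
        apply monotoneOn_of_deriv_nonneg (convex_Icc a b)
        · intro x hx
          exact (hf x (by linarith [hx.1]) (by linarith [hx.2])).continuousAt.continuousWithinAt
        · intro x hx
          rw [interior_Icc] at hx
          exact (hf x (by linarith [hx.1]) (by linarith [hx.2])).differentiableAt.differentiableWithinAt
        · intro x hx
          rw [interior_Icc] at hx
          rw [(hf x (by linarith [hx.1]) (by linarith [hx.2])).deriv]
          have := hx.1; have := hx.2
          apply div_nonneg
          · apply mul_nonneg (by linarith) (sq_nonneg _)
          · apply mul_nonneg <;> linarith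
      exact hm ⟨le_rfl, h⟩ ⟨h, le_rfl⟩ h
    · have hm : AntitoneOn f (Set.Icc b a) := by
        apply antitoneOn_of_deriv_nonpos (convex_Icc b a)
        · intro x hx
          exact (hf x (by linarith [hx.1]) (by linarith [hx.2])).continuousAt.continuousWithinAt
        · intro x hx
          rw [interior_Icc] at hx
          exact (hf x (by linarith [hx.1]) (by linarith [hx.2])).differentiableAt.differentiableWithinAt
        · intro x hx
          rw [interior_Icc] at hx
          rw [(hf x (by linarith [hx.1]) (by linarith [hx.2])).deriv]
          have := hx.1; have := hx.2
          apply div_nonpos_of_nonpos_of_nonneg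
          · apply mul_nonpos_of_nonpos_of_nonneg (by linarith) (sq_nonneg _)
          · apply mul_nonneg <;> linarith
      exact hm ⟨le_rfl, h⟩ ⟨h, le_rfl⟩ h
  simp only [f] at key
  nlinarith [key]

theorem bp {a b : ℝ} (ha : 0 ≤ a) (ha1 : a ≤ 1) (hb : 0 ≤ b) (hb1 : b ≤ 1)
    (h0 : b = 0 → a = 0) (h1 : 1 - b = 0 → 1 - a = 0) :
    2*(a-b)^2 ≤ a*(log a - log b) + (1-a)*(log (1-a) - log (1-b)) := by
  rcases hb.eq_or_lt with h | hb
  · rw [h0 h.symm, ← h]; simp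
  rcases hb1.eq_or_lt with h | hb1
  · have : a = 1 := by linarith [h1 (by linarith)]
    rw [this, h]; simp
  have hc : Continuous fun a : ℝ => (a * log a - a * log b) + ((1-a) * log (1-a) - (1-a) * log (1-b)) := by
    have h1 : Continuous fun a : ℝ => a * log a := continuous_mul_log
    have h2 : Continuous fun a : ℝ => (1-a) * log (1-a) := continuous_mul_log.comp (by fun_prop : Continuous fun a : ℝ => 1 - a)
    fun_prop
  have hcl : IsClosed {a : ℝ | 2*(a-b)^2 ≤ (a * log a - a * log b) + ((1-a) * log (1-a) - (1-a) * log (1-b))} :=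
    isClosed_le (by fun_prop) hc
  have hsub : Set.Ioo (0:ℝ) 1 ⊆ {a : ℝ | 2*(a-b)^2 ≤ (a * log a - a * log b) + ((1-a) * log (1-a) - (1-a) * log (1-b))} := by
    intro x hx
    have := bp0 hx.1 hx.2 hb hb1
    simp only [Set.mem_ofPred_eq]
    linarith
  have := closure_minimal hsub hcl
  rw [closure_Ioo (by norm_num)] at this
  have := this ⟨ha, ha1⟩
  simp only [Set.mem_ofPred_eq] at this
  linarith

/-- entropy-type scalar bound -/
theorem gB_scalar {s : ℝ} (hs : 0 ≤ s) (hs1 : s ≤ 1) :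
    1*(logb 2 (1+s^2) - logb 2 1) + s^2*(logb 2 (1+s^2) - logb 2 (s^2)) ≤ 4*s - 2*s^2 := by
  rcases hs.eq_or_lt with h | hs
  · rw [← h]; simp
  have l2 : 0.6931471803 < log 2 := log_two_gt_d9
  have l3 : log 2 < 0.6931471808 := log_two_lt_d9
  have key : (1+s^2) * log (1+s^2) - 2*s^2 * log s ≤ (4*s - 2*s^2) * log 2 := by
    rcases le_total (1/3) s with h | h
    · have p : 0 < 1 + s^2 := by positivity
      have e1 : log (2/(1+s^2)) ≥ 1 - (2/(1+s^2))⁻¹ := one_sub_inv_le_log_of_pos (by positivity)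
      have e2 : log ((1+s^2)/2) ≤ (1+s^2)/2 - 1 := log_le_sub_one_of_pos (by positivity)
      -- Gibbs: (1+s^2) log (1+s^2) - s^2 log s^2 ≤ (1+s^2) log 2
      have g1 : log ((1+s^2)/2) ≤ (1+s^2)/2 - 1 := e2
      have g2 : log ((1+s^2)/(2*s^2)) ≤ (1+s^2)/(2*s^2) - 1 := log_le_sub_one_of_pos (by positivity)
      rw [log_div (by positivity) (by norm_num)] at g1
      rw [log_div (by positivity) (by positivity), log_mul (by norm_num) (by positivity), log_pow] at g2
      have g3 := mul_le_mul_of_nonneg_left g2 (sq_nonneg s)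
      have e : s^2 * ((1+s^2)/(2*s^2) - 1) = (1+s^2)/2 - s^2 := by field_simp
      rw [e] at g3
      push_cast at g3
      nlinarith [mul_nonneg (mul_nonneg (by linarith : 0 ≤ 3*s-1) (by linarith : 0 ≤ 1 - s)) (by linarith : 0 ≤ log 2)]
    · have e1 : 1 - s⁻¹ ≤ log s := one_sub_inv_le_log_of_pos hs
      have e2 : log (1+s^2) ≤ s^2 := by linarith [log_le_sub_one_of_pos (show 0 < 1+s^2 by positivity)]
      have e3 := mul_le_mul_of_nonneg_left e1 (sq_nonneg s)
      have e : s^2 * (1 - s⁻¹) = s^2 - s := by field_simp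
      rw [e] at e3
      have e4 := mul_le_mul_of_nonneg_left e2 (show 0 ≤ 1 + s^2 by positivity)
      have : (1+s^2)*s^2 + 2*s - 2*s^2 ≤ (4*s - 2*s^2) * 0.6931471803 := by
        have : 0 ≤ s * ((1/3) - s) := by nlinarith
        nlinarith [mul_nonneg this hs.le, mul_nonneg (mul_nonneg this hs.le) hs.le]
      have : (4*s - 2*s^2) * 0.6931471803 ≤ (4*s - 2*s^2) * log 2 := by
        apply mul_le_mul_of_nonneg_left l2.le; nlinarith
      linarith
  have : 1*(logb 2 (1+s^2) - logb 2 1) + s^2*(logb 2 (1+s^2) - logb 2 (s^2))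
     = ((1+s^2) * log (1+s^2) - 2*s^2 * log s) / log 2 := by
    simp only [logb, log_pow, log_one]; push_cast
    field_simp
    ring
  rw [this, div_le_iff₀ (by linarith)]
  exact key

end Scalar
open Matrix

theorem conj_psd {n : Type*} [Fintype n] [DecidableEq n] (U : Matrix n n ℂ) (p : n → ℝ)
    (hp : ∀ i, 0 ≤ p i) : (U * rdiag p * Uᴴ).PosSemidef := by
  apply PosSemidef.mul_mul_conjTranspose_same
  apply PosSemidef.diagonal
  intro i
  have := hp i
  show (0 : ℂ) ≤ (p i : ℂ)
  exact_mod_cast this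

/-- Jordan decomposition together with the Pinsker inequality -/
theorem jordan_pinsker {n : Type*} [Fintype n] [DecidableEq n] (ρ σ : Matrix n n ℂ)
    (hρ : ρ.PosSemidef) (hσ : σ.PosSemidef) (hs : suppLe ρ σ) (hρ1 : ρ.trace = 1)
    (hσ1 : σ.trace = 1) :
    ∃ (ε : ℝ) (P N : Matrix n n ℂ), 0 ≤ ε ∧ ε ≤ 1 ∧ P.PosSemidef ∧ N.PosSemidef ∧
      P.trace = ε ∧ N.trace = ε ∧ ρ + N = σ + P ∧ 2 * ε ^ 2 ≤ Dr ρ σ * Real.log 2 := by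
  have hH : (ρ - σ).IsHermitian := hρ.1.sub hσ.1
  set W : Matrix n n ℂ := (hH.eigenvectorUnitary : Matrix n n ℂ) with hW
  set h := hH.eigenvalues with hh
  have hsp : ρ - σ = W * rdiag h * Wᴴ := exists_spec hH
  have hU : Wᴴ * W = 1 := eig_unitary hH
  have hadd : ∀ p q : n → ℝ, rdiag p - rdiag q = rdiag (fun i => p i - q i) := by
    intro p q; unfold rdiag; rw [diagonal_sub]; congr 1; funext i; push_cast; rfl
  have hmul : ∀ p q : n → ℝ, (W * rdiag p * Wᴴ) * (W * rdiag q * Wᴴ)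
      = W * rdiag (fun i => p i * q i) * Wᴴ := by
    intro p q
    have : rdiag p * rdiag q = rdiag (fun i => p i * q i) := by
      unfold rdiag; rw [diagonal_mul_diagonal]; congr 1; funext i; push_cast; rfl
    rw [← this]
    calc _ = W * rdiag p * (Wᴴ * W) * rdiag q * Wᴴ := by simp only [Matrix.mul_assoc]
      _ = _ := by rw [hU]; simp only [Matrix.mul_assoc, Matrix.mul_one, Matrix.one_mul]
  set Q : Matrix n n ℂ := W * rdiag (fun i => if 0 < h i then 1 else 0) * Wᴴ with hQ
  have hQQ : Q * Q = Q := by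
    rw [hQ, hmul]; congr 3; funext i; split_ifs <;> simp
  have hQH : Qᴴ = Q := rdiag_conj_herm W _
  set ε : ℝ := ∑ i, max (h i) 0 with hε
  have hsum : ∑ i, h i = 0 := by
    have := trace_spec W hU h
    rw [← hsp, trace_sub, hρ1, hσ1, sub_self] at this
    exact_mod_cast this.symm
  have hN : ∑ i, max (-h i) 0 = ε := by
    have : ∑ i, max (h i) 0 - ∑ i, max (-h i) 0 = ∑ i, h i := by
      rw [← Finset.sum_sub_distrib]
      refine Finset.sum_congr rfl fun i _ => ?_
      rcases le_total (h i) 0 with h0 | h0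
      · rw [max_eq_right h0, max_eq_left (by linarith)]; ring
      · rw [max_eq_left h0, max_eq_right (by linarith)]; ring
    linarith
  have hQt : (Q * ρ).trace - (Q * σ).trace = ε := by
    rw [← trace_sub, ← Matrix.mul_sub, hsp, hQ, hmul, trace_spec W hU]
    congr 1
    refine Finset.sum_congr rfl fun i _ => ?_
    split_ifs with h0
    · rw [max_eq_left h0.le, one_mul]
    · rw [max_eq_right (not_lt.mp h0), zero_mul]
  obtain ⟨a, b, a', b', ha, hb, ha', hb', e1, e2, e3, e4, z1, z2, hD⟩ :=
    Dr_proj ρ σ Q hρ hσ hs hQH hQQ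
  have hab : a + b = 1 := by
    have : ((a + b : ℝ) : ℂ) = 1 := by
      push_cast
      rw [← e1, ← e2, ← trace_add, ← Matrix.add_mul, add_sub_cancel, Matrix.one_mul, hρ1]
    exact_mod_cast this
  have hab' : a' + b' = 1 := by
    have : ((a' + b' : ℝ) : ℂ) = 1 := by
      push_cast
      rw [← e3, ← e4, ← trace_add, ← Matrix.add_mul, add_sub_cancel, Matrix.one_mul, hσ1]
    exact_mod_cast this
  have hea : a - a' = ε := by
    rw [e1, e3] at hQt
    exact_mod_cast hQt
  obtain rfl : b = 1 - a := by linarith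
  obtain rfl : b' = 1 - a' := by linarith
  refine ⟨ε, W * rdiag (fun i => max (h i) 0) * Wᴴ, W * rdiag (fun i => max (-h i) 0) * Wᴴ,
    Finset.sum_nonneg fun i _ => le_max_right _ _, by linarith,
    conj_psd _ _ fun i => le_max_right _ _, conj_psd _ _ fun i => le_max_right _ _,
    trace_spec W hU _, ?_, ?_, ?_⟩
  · rw [trace_spec W hU, hN]
  · have : ρ - σ = W * rdiag (fun i => max (h i) 0) * Wᴴ - W * rdiag (fun i => max (-h i) 0) * Wᴴ := by
      rw [hsp, ← Matrix.sub_mul, ← Matrix.mul_sub, hadd]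
      congr 3
      funext i
      rcases le_total (h i) 0 with h0 | h0
      · rw [max_eq_right h0, max_eq_left (by linarith)]; ring
      · rw [max_eq_left h0, max_eq_right (by linarith)]; ring
    rw [sub_eq_sub_iff_add_eq_add] at this
    rw [this, add_comm]
  · have hp := bp ha (by linarith) ha' (by linarith) z1 z2
    rw [hea] at hp
    have l2 : 0 < Real.log 2 := Real.log_pos (by norm_num)
    have := mul_le_mul_of_nonneg_right hD l2.le
    have e : (a * (Real.logb 2 a - Real.logb 2 a') + (1 - a) * (Real.logb 2 (1 - a) - Real.logb 2 (1 - a')))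
        * Real.log 2 = a * (Real.log a - Real.log a') + (1 - a) * (Real.log (1 - a) - Real.log (1 - a')) := by
      unfold Real.logb; field_simp
    linarith

theorem main_bound {A B C : Type*} [Fintype A] [Fintype B] [Fintype C]
    [DecidableEq A] [DecidableEq B] [DecidableEq C]
    (ρ : Matrix (A × B × C) (A × B × C) ℂ) (hρ : ρ.PosSemidef) (hρ1 : ρ.trace = 1)
    (R : Matrix B B ℂ →ₗ[ℂ] Matrix (B × C) (B × C) ℂ) (hR : IsCPTP R)
    (hs : suppLe ρ (tensorId (⇑R) (ptrC3 ρ))) :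
    (cmi ρ) ^ 4 / (8 * Real.log 2 * (Real.logb 2 (Fintype.card A) + 1) ^ 4)
      ≤ Dr ρ (tensorId (⇑R) (ptrC3 ρ)) := by
  have hc : tensorId (⇑(ptrSndLin (b := B) (c := C))) ρ = ptrC3 ρ := rfl
  have hτ : (ptrC3 ρ).PosSemidef := hc ▸ cp_general _ ptrSnd_cptp ρ hρ
  have hτ1 : (ptrC3 ρ).trace = 1 := by
    rw [← hc, tensorId_trace _ ptrSnd_cptp.1, hρ1]
  have hI0 : cE ρ ≤ cE (ptrC3 ρ) := hc ▸ cE_dpi _ ptrSnd_cptp hρ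
  have hI1 := cE_dpi R hR hτ
  have hσ := cp_general R hR _ hτ
  have hσ1 := (tensorId_trace R hR.1 (ptrC3 ρ)).trans hτ1
  have hpt : ptrSnd (ptrFst ρ) = ptrFst (ptrC3 ρ) := by
    ext x y
    exact Finset.sum_comm
  have hcmi : cmi ρ = cE (ptrC3 ρ) - cE ρ := by
    unfold cmi cE; rw [hpt]; ring
  set σ := tensorId (⇑R) (ptrC3 ρ) with hσd
  have : Nonempty A := by
    by_contra hA
    rw [not_nonempty_iff] at hA
    simp [trace] at hρ1
  obtain ⟨ε, P, N, h0, h1, hP, hN, tP, tN, hPN, hD⟩ := jordan_pinsker ρ σ hρ hσ hs hρ1 hσ1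
  have l2 : 0 < Real.log 2 := Real.log_pos (by norm_num)
  set L := Real.logb 2 (Fintype.card A) with hL
  have hL0 : 0 ≤ L := Real.logb_nonneg (by norm_num) (by exact_mod_cast Fintype.card_pos)
  have hI : 0 ≤ cmi ρ := by rw [hcmi]; linarith
  have hle : cmi ρ ≤ 2 * √ε * (L + 1) := by
    by_cases hA : Fintype.card A = 1
    · have hL' : L = 0 := by rw [hL, hA]; simp
      have a1 := cE_le hτ
      have a2 := cE_ge hρ
      rw [← hL, hL', mul_zero] at a1 a2
      have : cmi ρ ≤ 0 := by rw [hcmi]; linarith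
      have : 0 ≤ 2 * √ε * (L + 1) := by positivity
      linarith
    · have hL1 : 1 ≤ L := by
        have h2 : 2 ≤ Fintype.card A := by
          have := Fintype.card_pos (α := A); omega
        rw [hL, Real.le_logb_iff_rpow_le (by norm_num) (by positivity), Real.rpow_one]
        exact_mod_cast h2
      have a1 := cE_super hσ hP
      have a2 := cE_upper hρ hN
      rw [hPN, hρ1, tN] at a2
      have a3 := cE_le hN
      have a4 := cE_ge hP
      rw [tN] at a3
      rw [tP] at a4
      simp only [Complex.one_re, Complex.ofReal_re] at a2 a3 a4
      have a5 := gB_scalar (Real.sqrt_nonneg ε) (Real.sqrt_le_one.mpr h1)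
      have sq : √ε ^ 2 = ε := Real.sq_sqrt h0
      rw [sq] at a5
      have a6 : gB 1 ε ≤ 4 * √ε - 2 * ε := a5
      have s0 := Real.sqrt_nonneg ε
      have s1 : √ε ≤ 1 := Real.sqrt_le_one.mpr h1
      rw [← hL] at a3 a4
      have : cmi ρ ≤ 2 * ε * L + 4 * √ε - 2 * ε := by rw [hcmi]; linarith
      -- (2 L - 2)(√ε - ε) is nonnegative
      have : 0 ≤ (L - 1) * (√ε * (1 - √ε)) := by
        apply mul_nonneg (by linarith) (mul_nonneg s0 (by linarith))
      nlinarith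
  have h4 : cmi ρ ^ 4 ≤ 16 * ε ^ 2 * (L + 1) ^ 4 := by
    calc cmi ρ ^ 4 ≤ (2 * √ε * (L + 1)) ^ 4 := pow_le_pow_left₀ hI hle 4
      _ = 16 * (√ε ^ 2) ^ 2 * (L + 1) ^ 4 := by ring
      _ = _ := by rw [Real.sq_sqrt h0]
  rw [div_le_iff₀ (by positivity)]
  have := mul_le_mul_of_nonneg_right hD (show 0 ≤ 8 * (L + 1) ^ 4 by positivity)
  linarith

end QIT
open QIT in
/-- dimension-dependent bound:
`D(ρ_ABC ‖ (id_A⊗R)(ρ_AB)) ≥ I(A:C|B)_ρ^4 / (8 ln 2 (log₂(dim A) + 1)^4)`. -/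
theorem relEnt_ge_cmi_pow_four {A B C : Type*} [Fintype A] [Fintype B] [Fintype C]
    [DecidableEq A] [DecidableEq B] [DecidableEq C]
    (ρ : Matrix (A × B × C) (A × B × C) ℂ) (hρ : ρ.PosSemidef) (hρ1 : ρ.trace = 1)
    (R : Matrix B B ℂ →ₗ[ℂ] Matrix (B × C) (B × C) ℂ) (hR : IsCPTP R) :
    relEnt ρ (tensorId (⇑R) (ptrC3 ρ)) ≥
      (((cmi ρ) ^ 4 / (8 * Real.log 2 * (Real.logb 2 (Fintype.card A) + 1) ^ 4) : ℝ) : EReal) := by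
  unfold relEnt
  split_ifs with hs
  · exact EReal.coe_le_coe_iff.mpr (main_bound ρ hρ hρ1 R hR hs)
  · exact le_top
end
end

section
/- Let n ∈ ℕ, let X = {1, …, 2^n}, and let p, q ∈ [0,1] with p + q ≤ 1. Let P be the joint distribution on X×X×X of (X, Y, Z) defined as follows: X, U_Y, U_Z are independent and uniform on X; independently, E_Z ∈ {0,1} with Pr(E_Z = 0) = p+q, and E_Y ∈ {0,1,2} with Pr(E_Y = 0) = p and Pr(E_Y = 1) = q; set Z = X if E_Z = 0 and Z = U_Z otherwise; set Y = X if E_Y = 0, Y = Z if E_Y = 1, and Y = U_Y otherwise. Then I(X:Z|Y)_P ≥ n·(1−p−q)·(p+q) − log 6. -/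
noncomputable section

namespace CIT

/-- A probability distribution on a finite set. -/
def IsDist {X : Type*} [Fintype X] (p : X → ℝ) : Prop :=
  (∀ x, 0 ≤ p x) ∧ ∑ x, p x = 1

/-- Support inclusion `supp p ⊆ supp q`. -/
def suppLe {X : Type*} (p q : X → ℝ) : Prop := ∀ x, p x ≠ 0 → q x ≠ 0

open Classical in
/-- Relative entropy (base 2), with `0·log 0 = 0`, `+∞` if the support
condition fails. -/
def relEnt {X : Type*} [Fintype X] (p q : X → ℝ) : EReal :=
  if suppLe p q then ((∑ x, p x * Real.logb 2 (p x / q x) : ℝ) : EReal) else ⊤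

open Classical in
/-- Max-relative entropy `D_max(p‖q) = log max_{x ∈ supp p} p(x)/q(x)`,
`+∞` if the support condition fails. -/
def dMax {X : Type*} [Fintype X] (p q : X → ℝ) : EReal :=
  if suppLe p q then
    ((Real.logb 2 (sSup {r : ℝ | ∃ x, p x ≠ 0 ∧ r = p x / q x}) : ℝ) : EReal)
  else ⊤

open Classical in
/-- Rényi relative entropy of order `α` (base 2), with `D_1 := D` and `+∞`
when `α > 1` and the support condition fails. -/
def renyi {X : Type*} [Fintype X] (α : ℝ) (p q : X → ℝ) : EReal :=
  if α = 1 then relEnt p q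
  else if 1 < α ∧ ¬ suppLe p q then ⊤
  else (((α - 1)⁻¹ * Real.logb 2 (∑ x, p x ^ α * q x ^ (1 - α)) : ℝ) : EReal)

/-- The `XY`-marginal of a tripartite distribution. -/
def margXY {X Y Z : Type*} [Fintype Z] (P : X × Y × Z → ℝ) : X × Y → ℝ :=
  fun t => ∑ z, P (t.1, t.2, z)

/-- The `YZ`-marginal of a tripartite distribution. -/
def margYZ {X Y Z : Type*} [Fintype X] (P : X × Y × Z → ℝ) : Y × Z → ℝ :=
  fun t => ∑ x, P (x, t.1, t.2)

/-- The `Y`-marginal of a tripartite distribution. -/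
def margY {X Y Z : Type*} [Fintype X] [Fintype Z] (P : X × Y × Z → ℝ) : Y → ℝ :=
  fun y => ∑ x, ∑ z, P (x, y, z)

/-- Conditional mutual information
`I(X:Z|Y)_P = Σ P(x,y,z) log( P(x,y,z)·P_Y(y) / (P_XY(x,y)·P_YZ(y,z)) )`. -/
def cmi {X Y Z : Type*} [Fintype X] [Fintype Y] [Fintype Z] (P : X × Y × Z → ℝ) : ℝ :=
  ∑ s : X × Y × Z,
    P s * Real.logb 2 (P s * margY P s.2.1 / (margXY P (s.1, s.2.1) * margYZ P (s.2.1, s.2.2)))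

/-- A classical channel from `Y` to `W`: a family of conditional distributions. -/
def IsChannel {Y W : Type*} [Fintype W] (R : Y → W → ℝ) : Prop :=
  ∀ y, (∀ w, 0 ≤ R y w) ∧ ∑ w, R y w = 1

/-- Action `(id ⊗ R)` of a channel `R : Y → W` on a joint distribution on `X × Y`. -/
def applyChan {X Y W : Type*} [Fintype Y] (R : Y → W → ℝ) (P : X × Y → ℝ) : X × W → ℝ :=
  fun t => ∑ y, P (t.1, y) * R y t.2

/-- Action of a channel `R : Y → W` on a distribution on `Y`. -/
def chanOnDist {Y W : Type*} [Fintype Y] (R : Y → W → ℝ) (q : Y → ℝ) : W → ℝ :=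
  fun w => ∑ y, q y * R y w

/-- Marginal channel `R_{Y→Y}(y'|y) = Σ_{z'} R(y',z'|y)`. -/
def margChan {Y Y' Z' : Type*} [Fintype Z'] (R : Y → Y' × Z' → ℝ) : Y → Y' → ℝ :=
  fun y y' => ∑ z', R y (y', z')

end CIT

/-- `x log x`. -/
def gg (x : ℝ) : ℝ := x * Real.log x

lemma gg_add {a b : ℝ} (ha : 0 ≤ a) (hb : 0 ≤ b) : gg a + gg b ≤ gg (a + b) := by
  unfold gg
  rcases ha.eq_or_lt with rfl | ha
  · simp
  rcases hb.eq_or_lt with rfl | hb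
  · simp
  have h1 := Real.log_le_log ha (by linarith : a ≤ a + b)
  have h2 := Real.log_le_log hb (by linarith : b ≤ a + b)
  nlinarith

lemma gg_mul (a b : ℝ) : gg (a * b) = b * gg a + a * gg b := by
  unfold gg
  rcases eq_or_ne a 0 with rfl | ha
  · simp
  rcases eq_or_ne b 0 with rfl | hb
  · simp
  rw [Real.log_mul ha hb]; ring

lemma gg_lower {w : ℝ} (hw : 0 ≤ w) : -w * Real.log 6 + w - 1 / 6 ≤ gg w := by
  unfold gg
  rcases hw.eq_or_lt with rfl | hw
  · norm_num
  have h := Real.one_sub_inv_le_log_of_pos (by positivity : 0 < 6 * w)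
  rw [Real.log_mul (by norm_num) hw.ne'] at h
  have h2 := mul_le_mul_of_nonneg_left h hw.le
  have h3 : w * (1 - (6 * w)⁻¹) = w - 1 / 6 := by field_simp
  linarith

lemma gg_ind (c : ℝ) (b : Prop) [Decidable b] :
    gg (c * (if b then 1 else 0)) = gg c * (if b then 1 else 0) := by
  split_ifs <;> simp [gg]

open CIT in
lemma cmi_split {X Y Z : Type*} [Fintype X] [Fintype Y] [Fintype Z] (P : X × Y × Z → ℝ)
    (hP : ∀ s, 0 ≤ P s) :
    cmi P * Real.log 2 = ∑ s, gg (P s) + ∑ y, gg (margY P y)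
      - ∑ t, gg (margXY P t) - ∑ t, gg (margYZ P t) := by
  have h2 : Real.log 2 ≠ 0 := (Real.log_pos (by norm_num)).ne'
  have key : ∀ s : X × Y × Z,
      P s * Real.logb 2 (P s * margY P s.2.1 / (margXY P (s.1, s.2.1) * margYZ P (s.2.1, s.2.2)))
        * Real.log 2 = gg (P s) + P s * Real.log (margY P s.2.1)
        - P s * Real.log (margXY P (s.1, s.2.1)) - P s * Real.log (margYZ P (s.2.1, s.2.2)) := by
    rintro ⟨x, y, z⟩
    rcases (hP (x, y, z)).eq_or_lt with h | h
    · simp [← h, gg]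
    have h1 : 0 < margXY P (x, y) := lt_of_lt_of_le h
      (Finset.single_le_sum (f := fun z => P (x, y, z)) (fun _ _ => hP _) (Finset.mem_univ z))
    have h3 : 0 < margYZ P (y, z) := lt_of_lt_of_le h
      (Finset.single_le_sum (f := fun x => P (x, y, z)) (fun _ _ => hP _) (Finset.mem_univ x))
    have h4 : 0 < margY P y := lt_of_lt_of_le h1
      (Finset.single_le_sum (f := fun x => ∑ z, P (x, y, z))
        (fun _ _ => Finset.sum_nonneg fun _ _ => hP _) (Finset.mem_univ x))
    simp only [Real.logb, gg]
    rw [Real.log_div (by positivity) (by positivity), Real.log_mul h.ne' h4.ne',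
      Real.log_mul h1.ne' h3.ne']
    field_simp
    ring
  unfold cmi
  rw [Finset.sum_mul, Finset.sum_congr rfl (fun s _ => key s)]
  simp only [Finset.sum_sub_distrib, Finset.sum_add_distrib]
  congr 1
  · congr 1
    · congr 1
      simp only [Fintype.sum_prod_type, gg]
      rw [Finset.sum_comm]
      refine Finset.sum_congr rfl fun y _ => ?_
      simp only [← Finset.sum_mul]
      rfl
    · simp only [Fintype.sum_prod_type, gg, ← Finset.sum_mul]
      rfl
  · simp only [Fintype.sum_prod_type, gg]
    rw [Finset.sum_comm]
    refine Finset.sum_congr rfl fun y _ => ?_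
    rw [Finset.sum_comm]
    simp only [← Finset.sum_mul]
    rfl

lemma pair_bound (N : ℕ) (hN : 0 < N) (a b : ℝ) (ha : 0 ≤ a) (hb : 0 ≤ b) (hab : a + b = 1) :
    ∑ t : Fin N × Fin N, gg ((N : ℝ)⁻¹ * (a * (if t.2 = t.1 then 1 else 0) + b * (N : ℝ)⁻¹))
      ≤ -(1 + b) * Real.log N := by
  have hN' : (N : ℝ) ≠ 0 := by positivity
  have key : ∀ t : Fin N × Fin N,
      gg ((N : ℝ)⁻¹ * (a * (if t.2 = t.1 then 1 else 0) + b * (N : ℝ)⁻¹))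
      ≤ a * gg (N : ℝ)⁻¹ * (if t.2 = t.1 then 1 else 0) + b * gg ((N : ℝ)⁻¹ * (N : ℝ)⁻¹) := by
    intro t
    have h := Real.convexOn_mul_log.2
      (x := (N : ℝ)⁻¹ * (if t.2 = t.1 then 1 else 0)) (y := (N : ℝ)⁻¹ * (N : ℝ)⁻¹)
      (by simp only [Set.mem_Ici]; positivity) (by simp only [Set.mem_Ici]; positivity) ha hb hab
    simp only [smul_eq_mul] at h
    change gg _ ≤ a * gg _ + b * gg _ at h
    rw [gg_ind] at h
    convert h using 1
    · congr 1; ring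
    · ring
  refine (Finset.sum_le_sum fun t _ => key t).trans (le_of_eq ?_)
  rw [gg_mul]
  simp [Finset.sum_add_distrib, Fintype.sum_prod_type, gg]
  field_simp
  obtain rfl : a = 1 - b := by linarith
  ring

lemma triple_bound (N : ℕ) (hN : 0 < N) (p q r s : ℝ) (hp : 0 ≤ p) (hq : 0 ≤ q) (hs : 0 ≤ s)
    (hr : r = p + q) (hrs : r + s = 1) :
    -(1 + 2 * s) * Real.log N - Real.log 6 ≤ ∑ t : Fin N × Fin N × Fin N,
      gg ((N : ℝ)⁻¹ * (r * (if t.2.2 = t.1 then 1 else 0) + s * (N : ℝ)⁻¹) *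
        (p * (if t.2.1 = t.1 then 1 else 0) + q * (if t.2.1 = t.2.2 then 1 else 0) +
          s * (N : ℝ)⁻¹)) := by
  have hN' : (N : ℝ) ≠ 0 := by positivity
  have hr0 : 0 ≤ r := by linarith
  set c : ℝ := (N : ℝ)⁻¹ with hc
  have hc0 : 0 ≤ c := by positivity
  have key : ∀ t : Fin N × Fin N × Fin N,
      gg (r * r * c) * (if t.2.2 = t.1 ∧ t.2.1 = t.1 then 1 else 0)
      + gg (r * s * (c * c)) * (if t.2.2 = t.1 then 1 else 0)
      + gg (s * p * (c * c)) * (if t.2.1 = t.1 then 1 else 0)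
      + gg (s * q * (c * c)) * (if t.2.1 = t.2.2 then 1 else 0)
      + gg (s * s * (c * c * c)) ≤
      gg (c * (r * (if t.2.2 = t.1 then 1 else 0) + s * c) *
        (p * (if t.2.1 = t.1 then 1 else 0) + q * (if t.2.1 = t.2.2 then 1 else 0) + s * c)) := by
    rintro ⟨x, y, z⟩
    simp only [← gg_ind]
    refine (add_le_add_left ((add_le_add_left ((add_le_add_left (gg_add ?_ ?_) _).trans
      (gg_add ?_ ?_)) _).trans (gg_add ?_ ?_)) _).trans ((gg_add ?_ ?_).trans (le_of_eq ?_))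
    any_goals positivity
    congr 1
    by_cases h1 : z = x
    · subst h1
      by_cases h2 : y = z <;> simp [h2, hr] <;> ring
    · simp only [h1, false_and, if_false]; ring
  refine le_trans ?_ (Finset.sum_le_sum fun t _ => key t)
  have cnt : ∑ x : Fin N, ∑ y : Fin N, ∑ z : Fin N,
      (if z = x ∧ y = x then (1 : ℝ) else 0) = N := by
    simp [ite_and]
  simp only [Finset.sum_add_distrib, ← Finset.mul_sum, Fintype.sum_prod_type]
  have cnt2 : ∑ x : Fin N, ∑ y : Fin N, ∑ _z : Fin N,
      (if y = x then (1 : ℝ) else 0) = N * N := by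
    simp [← Finset.mul_sum]
  rw [cnt, cnt2]
  simp only [Finset.sum_ite_eq, Finset.sum_ite_eq', Finset.mem_univ, if_true, Finset.sum_const,
    Finset.card_univ, Fintype.card_fin, nsmul_eq_mul, mul_one]
  simp only [gg_mul _ c, gg_mul _ (c * c), gg_mul _ (c * c * c)]
  have e : gg c = - c * Real.log N := by simp [gg, hc]
  have f1 := gg_lower (mul_nonneg hr0 hr0)
  have f2 := gg_lower (mul_nonneg hr0 hs)
  have f3 := gg_lower (mul_nonneg hs hp)
  have f4 := gg_lower (mul_nonneg hs hq)
  have f5 := gg_lower (mul_nonneg hs hs)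
  have tot : r * r + r * s + s * p + s * q + s * s = 1 := by
    have : s = 1 - r := by linarith
    subst this; subst hr; ring
  have hl : 0 ≤ Real.log 6 := Real.log_nonneg (by norm_num)
  rw [e]
  have hNc : (N : ℝ) * c = 1 := by rw [hc]; field_simp
  have lhs : -(1 + 2 * s) * Real.log N - Real.log 6 ≤
      (gg (r * r) + gg (r * s) + gg (s * p) + gg (s * q) + gg (s * s))
      - (r * r + 2 * (r * s + s * p + s * q) + 3 * (s * s)) * Real.log N := by
    have : r * r + 2 * (r * s + s * p + s * q) + 3 * (s * s) = 1 + 2 * s := by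
      have : s = 1 - r := by linarith
      subst this; subst hr; ring
    rw [this]
    have : (r * r + r * s + s * p + s * q + s * s) * Real.log 6 = Real.log 6 := by
      rw [tot, one_mul]
    linarith
  refine lhs.trans (le_of_eq ?_)
  rw [hc]
  field_simp
  ring

open CIT in
/-- the distribution of `(X,Y,Z)` (X uniform; Z = X with
prob. p+q else uniform; Y = X with prob. p, Y = Z with prob. q, else uniform)
satisfies `I(X:Z|Y)_P ≥ n(1−p−q)(p+q) − log 6`. -/
theorem cmi_lower_bound_example (n : ℕ) (p q : ℝ)
    (hp0 : 0 ≤ p) (hp1 : p ≤ 1) (hq0 : 0 ≤ q) (hq1 : q ≤ 1) (hpq : p + q ≤ 1)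
    (P : Fin (2 ^ n) × Fin (2 ^ n) × Fin (2 ^ n) → ℝ)
    (hP : P = fun s =>
      ((2 ^ n : ℕ) : ℝ)⁻¹ *
        ((p + q) * (if s.2.2 = s.1 then 1 else 0) + (1 - p - q) * ((2 ^ n : ℕ) : ℝ)⁻¹) *
        (p * (if s.2.1 = s.1 then 1 else 0) + q * (if s.2.1 = s.2.2 then 1 else 0) +
          (1 - p - q) * ((2 ^ n : ℕ) : ℝ)⁻¹)) :
    (n : ℝ) * (1 - p - q) * (p + q) - Real.logb 2 6 ≤ cmi P := by
  have hN : 0 < 2 ^ n := by positivity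
  have hlog : Real.log ((2 ^ n : ℕ) : ℝ) = n * Real.log 2 := by
    push_cast; rw [Real.log_pow]
  generalize 2 ^ n = N at *
  have hN' : (N : ℝ) ≠ 0 := by positivity
  obtain ⟨s, hs⟩ : ∃ s, s = 1 - p - q := ⟨_, rfl⟩
  rw [← hs] at hP ⊢
  have hs0 : 0 ≤ s := by linarith
  have hpe : p = 1 - s - q := by linarith
  have hl2 : 0 < Real.log 2 := Real.log_pos (by norm_num)
  have hP0 : ∀ t, 0 ≤ P t := by
    intro t; rw [hP]; positivity
  have hXY : ∀ t, margXY P t = (N : ℝ)⁻¹ *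
      (((p + q) * (p + q) + s * p) * (if t.2 = t.1 then 1 else 0) + s * (1 + q) * (N : ℝ)⁻¹) := by
    rintro ⟨x, y⟩
    simp only [margXY, hP]
    by_cases h : y = x
    · subst h
      simp [mul_add, add_mul, Finset.sum_add_distrib, ← Finset.mul_sum, ← Finset.sum_mul]
      field_simp
      rw [hpe]; ring
    · simp [mul_add, add_mul, Finset.sum_add_distrib, ← Finset.mul_sum, ← Finset.sum_mul, h]
      field_simp
      rw [hpe]; ring
  have hYZ : ∀ t, margYZ P t = (N : ℝ)⁻¹ *
      (((p + q) * (p + q) + s * q) * (if t.2 = t.1 then 1 else 0) + s * (1 + p) * (N : ℝ)⁻¹) := by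
    rintro ⟨y, z⟩
    simp only [margYZ, hP]
    by_cases h : z = y
    · subst h
      simp [mul_add, add_mul, Finset.sum_add_distrib, ← Finset.mul_sum, ← Finset.sum_mul]
      field_simp
      rw [hpe]; ring
    · have h' : ¬ y = z := fun e => h e.symm
      simp [mul_add, add_mul, Finset.sum_add_distrib, ← Finset.mul_sum, ← Finset.sum_mul, h, h']
      field_simp
      rw [hpe]; ring
  have hY : ∀ y, margY P y = (N : ℝ)⁻¹ := by
    intro y
    have : margY P y = ∑ x, margXY P (x, y) := rfl
    rw [this]
    simp only [hXY]
    simp [Finset.sum_add_distrib, ← Finset.mul_sum]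
    field_simp
    rw [hpe]; ring
  have hsplit := cmi_split P hP0
  have t3 := triple_bound N hN p q (p + q) s hp0 hq0 hs0 rfl (by linarith)
  have t1 := pair_bound N hN ((p + q) * (p + q) + s * p) (s * (1 + q)) (by positivity)
    (by positivity) (by rw [hpe]; ring)
  have t2 := pair_bound N hN ((p + q) * (p + q) + s * q) (s * (1 + p)) (by positivity)
    (by positivity) (by rw [hpe]; ring)
  simp only [← hXY] at t1
  simp only [← hYZ] at t2
  have t3' : -(1 + 2 * s) * Real.log N - Real.log 6 ≤ ∑ t, gg (P t) := by
    rw [hP]; exact t3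
  have t4 : ∑ y, gg (margY P y) = - Real.log N := by
    simp only [hY]
    simp [gg]
    field_simp
  have hfin : ((n : ℝ) * s * (p + q) - Real.logb 2 6) * Real.log 2 ≤ cmi P * Real.log 2 := by
    rw [hsplit, t4, sub_mul, Real.logb, div_mul_cancel₀ _ hl2.ne']
    have : (n : ℝ) * s * (p + q) * Real.log 2 = s * (p + q) * Real.log N := by
      rw [hlog]; ring
    rw [this]
    linarith
  exact le_of_mul_le_mul_right hfin hl2
end
end
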